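/- Under the standing assumptions (smooth 1-periodic drift and diffusion coefficients with uniformly elliptic diffusion matrices, and smooth, bounded, 1-periodic, irreducible switching intensities), there exists exactly one function m : ℝ^d × 𝕀 → [0,∞) such that: m(·,α) is C² for every α ∈ 𝕀; m is 1-periodic in x; ℒ*m(x,α) = 0 for all (x,α) ∈ ℝ^d × 𝕀; and ∑_{α=1}^{𝚖} ∫_{𝕋^d} m(x,α) dx = 1. -/

import Mathlib

open MeasureTheory Matrix Finset

noncomputable section

/-- Partial derivative `∂f/∂x_j` of a function on `ℝ^d`. -/
def pd {d : ℕ} (f : (Fin d → ℝ) → ℝ) (j : Fin d) (x : Fin d → ℝ) : ℝ :=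
  fderiv ℝ f x (Pi.single j 1)

/-- Second partial derivative `∂²f/∂x_j∂x_k`. -/
def pd2 {d : ℕ} (f : (Fin d → ℝ) → ℝ) (j k : Fin d) (x : Fin d → ℝ) : ℝ :=
  pd (fun y => pd f j y) k x

/-- `1`-periodicity of a function on `ℝ^d`. -/
def Per {d : ℕ} (f : (Fin d → ℝ) → ℝ) : Prop :=
  ∀ (x : Fin d → ℝ) (ν : Fin d → ℤ), f (x + fun i => (ν i : ℝ)) = f x

/-- Integral over the fundamental domain `[0,1)^d` of the torus `𝕋^d`. -/
def tInt {d : ℕ} (f : (Fin d → ℝ) → ℝ) : ℝ :=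
  ∫ x in Set.pi Set.univ (fun _ : Fin d => Set.Ico (0:ℝ) 1), f x

/-- Diffusion matrix `a(x,α) = σ(x,α) σ(x,α)ᵀ`. -/
def diffMat {d r m : ℕ} (σ : (Fin d → ℝ) → Fin m → Matrix (Fin d) (Fin r) ℝ)
    (x : Fin d → ℝ) (α : Fin m) : Matrix (Fin d) (Fin d) ℝ :=
  σ x α * (σ x α)ᵀ

/-- The jump part `Qf(x,α) = ∑_{β ≠ α} q_{αβ}(x) [f(x,β) - f(x,α)]` of the generator. -/
def jumpOp {d m : ℕ} (q : Fin m → Fin m → (Fin d → ℝ) → ℝ)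
    (f : (Fin d → ℝ) → Fin m → ℝ) (x : Fin d → ℝ) (α : Fin m) : ℝ :=
  ∑ β ∈ Finset.univ.filter (fun β => β ≠ α), q α β x * (f x β - f x α)

/-- The generator `ℒ` of the switching diffusion. -/
def gen {d m : ℕ} (b : (Fin d → ℝ) → Fin m → Fin d → ℝ)
    (a : (Fin d → ℝ) → Fin m → Matrix (Fin d) (Fin d) ℝ)
    (q : Fin m → Fin m → (Fin d → ℝ) → ℝ)
    (f : (Fin d → ℝ) → Fin m → ℝ) (x : Fin d → ℝ) (α : Fin m) : ℝ :=
  (∑ j, b x α j * pd (fun y => f y α) j x)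
    + (1/2) * ∑ j, ∑ k, a x α j k * pd2 (fun y => f y α) j k x
    + jumpOp q f x α

/-- The formal `L²`-adjoint `ℒ*`; its jump part uses the transposed intensity matrix and
includes the diagonal term. -/
def genAdj {d m : ℕ} (b : (Fin d → ℝ) → Fin m → Fin d → ℝ)
    (a : (Fin d → ℝ) → Fin m → Matrix (Fin d) (Fin d) ℝ)
    (q : Fin m → Fin m → (Fin d → ℝ) → ℝ)
    (g : (Fin d → ℝ) → Fin m → ℝ) (x : Fin d → ℝ) (α : Fin m) : ℝ :=
  -(∑ j, pd (fun y => b y α j * g y α) j x)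
    + (1/2) * ∑ j, ∑ k, pd2 (fun y => a y α j k * g y α) j k x
    + ∑ β, q β α x * g x β



/-! ### Calculus helpers -/

lemma pd_mul {d : ℕ} {f g : (Fin d → ℝ) → ℝ} {x : Fin d → ℝ} (hf : DifferentiableAt ℝ f x)
    (hg : DifferentiableAt ℝ g x) (j : Fin d) :
    pd (fun y => f y * g y) j x = pd f j x * g x + f x * pd g j x := by
  unfold pd
  rw [fderiv_fun_mul hf hg]
  simp
  ring

lemma pd_add {d : ℕ} {f g : (Fin d → ℝ) → ℝ} {x : Fin d → ℝ} (hf : DifferentiableAt ℝ f x)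
    (hg : DifferentiableAt ℝ g x) (j : Fin d) :
    pd (fun y => f y + g y) j x = pd f j x + pd g j x := by
  unfold pd
  rw [fderiv_fun_add hf hg]
  simp

lemma pd_sub {d : ℕ} {f g : (Fin d → ℝ) → ℝ} {x : Fin d → ℝ} (hf : DifferentiableAt ℝ f x)
    (hg : DifferentiableAt ℝ g x) (j : Fin d) :
    pd (fun y => f y - g y) j x = pd f j x - pd g j x := by
  unfold pd
  rw [fderiv_fun_sub hf hg]
  simp

lemma pd_const_mul {d : ℕ} {f : (Fin d → ℝ) → ℝ} {x : Fin d → ℝ} (hf : DifferentiableAt ℝ f x)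
    (c : ℝ) (j : Fin d) :
    pd (fun y => c * f y) j x = c * pd f j x := by
  unfold pd
  rw [fderiv_const_mul hf c]
  simp

lemma contDiff_pd {d : ℕ} {n k : WithTop ℕ∞} {f : (Fin d → ℝ) → ℝ} (hf : ContDiff ℝ k f)
    (h : n + 1 ≤ k) (j : Fin d) : ContDiff ℝ n (fun x => pd f j x) := by
  unfold pd
  exact (hf.fderiv_right h).clm_apply contDiff_const

lemma contDiff_one_pd {d : ℕ} {f : (Fin d → ℝ) → ℝ} (hf : ContDiff ℝ 2 f)
    (j : Fin d) : ContDiff ℝ 1 (fun x => pd f j x) :=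
  contDiff_pd hf (by norm_num) j

lemma continuous_pd2 {d : ℕ} {f : (Fin d → ℝ) → ℝ} (hf : ContDiff ℝ 2 f)
    (j k : Fin d) : Continuous (fun x => pd2 f j k x) := by
  unfold pd2
  exact (contDiff_pd (n := 0) (contDiff_one_pd hf j) (by norm_num) k).continuous

lemma pd2_mul {d : ℕ} {f g : (Fin d → ℝ) → ℝ} (hf : ContDiff ℝ 2 f)
    (hg : ContDiff ℝ 2 g) (j k : Fin d) (x : Fin d → ℝ) :
    pd2 (fun y => f y * g y) j k x = pd2 f j k x * g x + pd f j x * pd g k x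
      + pd f k x * pd g j x + f x * pd2 g j k x := by
  have df := hf.differentiable (by norm_num)
  have dg := hg.differentiable (by norm_num)
  have df' := (contDiff_one_pd hf j).differentiable (by norm_num)
  have dg' := (contDiff_one_pd hg j).differentiable (by norm_num)
  have h : (fun y => pd (fun z => f z * g z) j y) = fun y => pd f j y * g y + f y * pd g j y := by
    funext y
    exact pd_mul (df y) (dg y) j
  unfold pd2
  rw [h, pd_add ((df' x).fun_mul (dg x)) ((df x).fun_mul (dg' x)), pd_mul (df' x) (dg x),
    pd_mul (df x) (dg' x)]
  ring

lemma pd2_sub {d : ℕ} {f g : (Fin d → ℝ) → ℝ} (hf : ContDiff ℝ 2 f)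
    (hg : ContDiff ℝ 2 g) (j k : Fin d) (x : Fin d → ℝ) :
    pd2 (fun y => f y - g y) j k x = pd2 f j k x - pd2 g j k x := by
  have h : (fun y => pd (fun z => f z - g z) j y) = fun y => pd f j y - pd g j y := by
    funext y
    exact pd_sub (hf.differentiable (by norm_num) y) (hg.differentiable (by norm_num) y) j
  unfold pd2
  rw [h, pd_sub ((contDiff_one_pd hf j).differentiable (by norm_num) x)
    ((contDiff_one_pd hg j).differentiable (by norm_num) x)]

lemma pd2_add {d : ℕ} {f g : (Fin d → ℝ) → ℝ} (hf : ContDiff ℝ 2 f)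
    (hg : ContDiff ℝ 2 g) (j k : Fin d) (x : Fin d → ℝ) :
    pd2 (fun y => f y + g y) j k x = pd2 f j k x + pd2 g j k x := by
  have h : (fun y => pd (fun z => f z + g z) j y) = fun y => pd f j y + pd g j y := by
    funext y
    exact pd_add (hf.differentiable (by norm_num) y) (hg.differentiable (by norm_num) y) j
  unfold pd2
  rw [h, pd_add ((contDiff_one_pd hf j).differentiable (by norm_num) x)
    ((contDiff_one_pd hg j).differentiable (by norm_num) x)]

lemma pd2_const_mul {d : ℕ} {f : (Fin d → ℝ) → ℝ} (hf : ContDiff ℝ 2 f)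
    (c : ℝ) (j k : Fin d) (x : Fin d → ℝ) :
    pd2 (fun y => c * f y) j k x = c * pd2 f j k x := by
  have h : (fun y => pd (fun z => c * f z) j y) = fun y => c * pd f j y := by
    funext y
    exact pd_const_mul (hf.differentiable (by norm_num) y) c j
  unfold pd2
  rw [h, pd_const_mul ((contDiff_one_pd hf j).differentiable (by norm_num) x)]

lemma fderiv_eq_sum_pd {d : ℕ} (f : (Fin d → ℝ) → ℝ) (x ξ : Fin d → ℝ) :
    fderiv ℝ f x ξ = ∑ j, ξ j * pd f j x := by
  unfold pd
  conv_lhs => rw [pi_eq_sum_univ' ξ]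
  rw [map_sum]
  refine Finset.sum_congr rfl fun i _ => ?_
  rw [map_smul, smul_eq_mul]

/-- Derivative along a line. -/
lemma hasDerivAt_line {d : ℕ} {f : (Fin d → ℝ) → ℝ} (hf : Differentiable ℝ f)
    (x ξ : Fin d → ℝ) (t : ℝ) :
    HasDerivAt (fun s : ℝ => f (x + s • ξ)) (∑ j, ξ j * pd f j (x + t • ξ)) t := by
  rw [← fderiv_eq_sum_pd]
  have h1 : HasDerivAt (fun s : ℝ => x + s • ξ) ξ t := by
    simpa using ((hasDerivAt_id t).smul_const ξ).const_add x
  exact (hf _).hasFDerivAt.comp_hasDerivAt t h1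

/-- One dimensional second derivative test (necessary condition). -/
lemma second_deriv_nonneg {φ : ℝ → ℝ} {x : ℝ} (h : IsLocalMin φ x) (hc : ContinuousAt φ x) :
    0 ≤ deriv (deriv φ) x := by
  by_contra hneg
  push Not at hneg
  have hmax := isLocalMax_of_deriv_deriv_neg hneg h.deriv_eq_zero hc
  have hconst : φ =ᶠ[nhds x] fun _ => φ x := by
    filter_upwards [h, hmax] with y h1 h2
    exact le_antisymm h2 h1
  have h2 : deriv φ =ᶠ[nhds x] fun _ => 0 := by
    have := hconst.deriv
    simpa using this
  have := h2.deriv_eq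
  simp at this
  linarith

lemma hess_nonneg {d : ℕ} {f : (Fin d → ℝ) → ℝ} (hf : ContDiff ℝ 2 f) {x : Fin d → ℝ}
    (h : IsLocalMin f x) (ξ : Fin d → ℝ) : 0 ≤ ∑ j, ∑ k, ξ j * ξ k * pd2 f j k x := by
  have hlin : Filter.Tendsto (fun s : ℝ => x + s • ξ) (nhds 0) (nhds x) := by
    have : Continuous (fun s : ℝ => x + s • ξ) := by fun_prop
    simpa using this.tendsto 0
  have hmin : IsLocalMin (fun s : ℝ => f (x + s • ξ)) 0 := by
    have h' := hlin.eventually h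
    filter_upwards [h'] with s hs
    simpa using hs
  have hcont : ContinuousAt (fun s : ℝ => f (x + s • ξ)) 0 := by
    have := hf.continuous
    fun_prop
  have h2 := second_deriv_nonneg hmin hcont
  have e1 : deriv (fun s : ℝ => f (x + s • ξ)) = fun t => ∑ j, ξ j * pd f j (x + t • ξ) := by
    funext t
    exact (hasDerivAt_line (hf.differentiable (by norm_num)) x ξ t).deriv
  have e2 : HasDerivAt (fun t : ℝ => ∑ j, ξ j * pd f j (x + t • ξ))
      (∑ j, ξ j * ∑ k, ξ k * pd (fun y => pd f j y) k (x + (0:ℝ) • ξ)) 0 := by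
    apply HasDerivAt.fun_sum
    intro j _
    exact (hasDerivAt_line ((contDiff_one_pd hf j).differentiable (by norm_num)) x ξ 0).const_mul _
  rw [e1, e2.deriv] at h2
  simp only [zero_smul, add_zero] at h2
  refine h2.trans (le_of_eq ?_)
  refine Finset.sum_congr rfl fun j _ => ?_
  rw [Finset.mul_sum]
  refine Finset.sum_congr rfl fun k _ => ?_
  rw [pd2]; ring

lemma pd_eq_zero_of_min {d : ℕ} {f : (Fin d → ℝ) → ℝ} {x : Fin d → ℝ}
    (h : IsLocalMin f x) (j : Fin d) : pd f j x = 0 := by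
  unfold pd
  rw [h.fderiv_eq_zero]; simp

lemma diffMat_apply {d r m : ℕ} (σ : (Fin d → ℝ) → Fin m → Matrix (Fin d) (Fin r) ℝ)
    (x : Fin d → ℝ) (α : Fin m) (j k : Fin d) :
    diffMat σ x α j k = ∑ i, σ x α j i * σ x α k i := by
  simp [diffMat, Matrix.mul_apply]

/-- At a minimum, the diffusion part is nonnegative. -/
lemma diffusion_nonneg_of_min {d r m : ℕ}
    (σ : (Fin d → ℝ) → Fin m → Matrix (Fin d) (Fin r) ℝ)
    {f : (Fin d → ℝ) → ℝ} (hf : ContDiff ℝ 2 f) {x : Fin d → ℝ}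
    (h : IsLocalMin f x) (α : Fin m) :
    0 ≤ ∑ j, ∑ k, diffMat σ x α j k * pd2 f j k x := by
  have e : ∑ j, ∑ k, diffMat σ x α j k * pd2 f j k x
      = ∑ i, ∑ j, ∑ k, σ x α j i * σ x α k i * pd2 f j k x := by
    simp_rw [diffMat_apply, Finset.sum_mul]
    rw [Finset.sum_comm' (t' := Finset.univ) (s' := fun _ => Finset.univ) (by simp)]
    rw [Finset.sum_comm]
    rw [Finset.sum_comm (s := Finset.univ (α := Fin r))]
    refine Finset.sum_congr rfl fun j _ => ?_
    rw [Finset.sum_comm]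
  rw [e]
  exact Finset.sum_nonneg fun i _ => hess_nonneg hf h fun j => σ x α j i


/-! ### Strong maximum principle -/

/-- squared Euclidean distance to `y` -/
def sqd {d : ℕ} (y z : Fin d → ℝ) : ℝ := ∑ i, (z i - y i) ^ 2

lemma contDiff_sqd {d : ℕ} (y : Fin d → ℝ) {n : WithTop ℕ∞} : ContDiff ℝ n (sqd y) := by
  unfold sqd
  fun_prop

lemma pd_sqd {d : ℕ} (y z : Fin d → ℝ) (j : Fin d) : pd (sqd y) j z = 2 * (z j - y j) := by
  have h : HasFDerivAt (sqd y) (∑ i, (2 * (z i - y i)) •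
      (ContinuousLinearMap.proj (R := ℝ) (φ := fun _ : Fin d => ℝ) i)) z := by
    unfold sqd
    apply HasFDerivAt.fun_sum
    intro i _
    have h1 : HasFDerivAt (fun z : Fin d → ℝ => z i - y i)
      (ContinuousLinearMap.proj (R := ℝ) (φ := fun _ : Fin d => ℝ) i) z :=
      (ContinuousLinearMap.proj (R := ℝ) (φ := fun _ : Fin d => ℝ) i).hasFDerivAt.sub_const _
    simpa using h1.pow 2
  unfold pd
  rw [h.fderiv]
  simp [Pi.single_apply]

lemma pd_exp {d : ℕ} {f : (Fin d → ℝ) → ℝ} (hf : Differentiable ℝ f) (j : Fin d)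
    (x : Fin d → ℝ) : pd (fun z => Real.exp (f z)) j x = Real.exp (f x) * pd f j x := by
  unfold pd
  rw [fderiv_exp (hf x)]
  simp

lemma pd_barrier {d : ℕ} (y : Fin d → ℝ) (l : ℝ) (j : Fin d) (z : Fin d → ℝ) :
    pd (fun z => Real.exp (-l * sqd y z)) j z
      = -2 * l * ((z j - y j) * Real.exp (-l * sqd y z)) := by
  have hd : Differentiable ℝ (sqd y) := (contDiff_sqd y (n := 1)).differentiable (by norm_num)
  rw [pd_exp (hd.const_mul (-l)), pd_const_mul (hd z), pd_sqd]
  ring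

lemma pd_coord_sub {d : ℕ} (y z : Fin d → ℝ) (j k : Fin d) :
    pd (fun z => z j - y j) k z = if j = k then 1 else 0 := by
  have h1 : HasFDerivAt (fun z : Fin d → ℝ => z j - y j)
      (ContinuousLinearMap.proj (R := ℝ) (φ := fun _ : Fin d => ℝ) j) z :=
      (ContinuousLinearMap.proj (R := ℝ) (φ := fun _ : Fin d => ℝ) j).hasFDerivAt.sub_const _
  unfold pd
  rw [h1.fderiv]
  simp [Pi.single_apply]

lemma pd2_barrier {d : ℕ} (y : Fin d → ℝ) (l : ℝ) (j k : Fin d) (z : Fin d → ℝ) :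
    pd2 (fun z => Real.exp (-l * sqd y z)) j k z
      = (4 * l ^ 2 * ((z j - y j) * (z k - y k)) - 2 * l * (if j = k then 1 else 0))
        * Real.exp (-l * sqd y z) := by
  have hd : Differentiable ℝ (fun z => Real.exp (-l * sqd y z)) :=
    ((contDiff_const.mul (contDiff_sqd y (n := 1))).exp).differentiable (by norm_num)
  have hj : Differentiable ℝ (fun z : Fin d → ℝ => z j - y j) := by fun_prop
  unfold pd2
  have e : (fun z => pd (fun z => Real.exp (-l * sqd y z)) j z) =
      fun z => -2 * l * ((z j - y j) * Real.exp (-l * sqd y z)) := by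
    funext z; exact pd_barrier y l j z
  rw [e, pd_const_mul ((hj z).fun_mul (hd z)), pd_mul (hj z) (hd z), pd_coord_sub, pd_barrier]
  ring

lemma isCompact_sqd_le {d : ℕ} (y : Fin d → ℝ) (R : ℝ) : IsCompact {z | sqd y z ≤ R} := by
  refine Metric.isCompact_of_isClosed_isBounded
    (isClosed_le (contDiff_sqd y (n := 0)).continuous continuous_const) ?_
  refine (Metric.isBounded_closedBall (x := y) (r := R + 1)).subset ?_
  intro z hz
  change sqd y z ≤ R at hz
  have h0 : ∀ i, (z i - y i) ^ 2 ≤ R := fun i => by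
    refine le_trans ?_ hz
    unfold sqd
    exact Finset.single_le_sum (f := fun i => (z i - y i) ^ 2) (fun i _ => sq_nonneg _)
      (Finset.mem_univ i)
  have hR : 0 ≤ R := le_trans (Finset.sum_nonneg fun i _ => sq_nonneg _) hz
  rw [Metric.mem_closedBall, dist_pi_le_iff (by linarith)]
  intro i
  rw [Real.dist_eq]
  have := h0 i
  rw [abs_le]
  constructor <;> nlinarith

lemma exists_bound_on {d : ℕ} {K : Set (Fin d → ℝ)} (hK : IsCompact K) {f : (Fin d → ℝ) → ℝ}
    (hf : Continuous f) : ∃ C, 0 ≤ C ∧ ∀ x ∈ K, |f x| ≤ C := by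
  obtain ⟨C, hC⟩ := hK.exists_bound_of_continuousOn hf.continuousOn
  exact ⟨max C 0, le_max_right _ _, fun x hx => (hC x hx).trans (le_max_left _ _)⟩

lemma pos_propagate {d r m : ℕ} (σ : (Fin d → ℝ) → Fin m → Matrix (Fin d) (Fin r) ℝ)
    (α : Fin m) (amin : ℝ) (hamin : 0 < amin)
    (hσ : ∀ i j, Continuous fun x => σ x α i j)
    (hell : ∀ (x ξ : Fin d → ℝ), amin * ∑ i, ξ i ^ 2 ≤ ξ ⬝ᵥ (diffMat σ x α *ᵥ ξ))
    (g : (Fin d → ℝ) → ℝ) (hg : ContDiff ℝ 2 g) (hg0 : ∀ x, 0 ≤ g x)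
    (B : Fin d → (Fin d → ℝ) → ℝ) (hB : ∀ k, Continuous (B k))
    (c : (Fin d → ℝ) → ℝ) (hc : Continuous c)
    (hineq : ∀ x, (1/2) * ∑ j, ∑ k, diffMat σ x α j k * pd2 g j k x
      + ∑ k, B k x * pd g k x + c x * g x ≤ 0)
    (y : Fin d → ℝ) (hy : 0 < g y) (x : Fin d → ℝ) : 0 < g x := by
  have hsqc : Continuous (sqd y) := (contDiff_sqd y (n := 0)).continuous
  have hsq0 : ∀ z, 0 ≤ sqd y z := fun z => Finset.sum_nonneg fun i _ => sq_nonneg _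
  -- lower bound near y
  obtain ⟨ρ, hρ, hball⟩ : ∃ ρ > 0, ∀ z, sqd y z ≤ ρ → g y / 2 ≤ g z := by
    have h1 : ∀ᶠ z in nhds y, g y / 2 < g z :=
      hg.continuous.continuousAt.eventually (lt_mem_nhds (by linarith))
    obtain ⟨ε, hε, hb⟩ := Metric.eventually_nhds_iff.1 h1
    refine ⟨(ε / 2) ^ 2, by positivity, fun z hz => (hb ?_).le⟩
    have : dist z y ≤ ε / 2 := by
      rw [dist_pi_le_iff (by linarith)]
      intro i
      have h2 : (z i - y i) ^ 2 ≤ (ε / 2) ^ 2 := le_trans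
        (Finset.single_le_sum (f := fun i => (z i - y i) ^ 2) (fun i _ => sq_nonneg _)
          (Finset.mem_univ i)) hz
      rw [Real.dist_eq]
      exact abs_le_of_sq_le_sq h2 (by linarith)
    linarith
  set R := sqd y x + 1 with hR
  have hK := isCompact_sqd_le y R
  have ha : ∀ j k, Continuous fun x => diffMat σ x α j k := by
    intro j k
    simp_rw [diffMat_apply]
    exact continuous_finsetSum _ fun i _ => (hσ j i).mul (hσ k i)
  obtain ⟨K1, hK10, hK1⟩ := exists_bound_on hK (f := fun z => ∑ j, diffMat σ z α j j)
    (continuous_finsetSum _ fun j _ => ha j j)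
  obtain ⟨K2, hK20, hK2⟩ := exists_bound_on hK (f := fun z => ∑ k, B k z * (z k - y k))
    (continuous_finsetSum _ fun j _ => (hB j).mul (by fun_prop))
  obtain ⟨K3, hK31, hK3⟩ : ∃ C, 0 < C ∧ ∀ x ∈ {z | sqd y z ≤ R}, |c x| ≤ C := by
    obtain ⟨C, h0, hC⟩ := exists_bound_on hK hc
    exact ⟨C + 1, by linarith, fun x hx => (hC x hx).trans (by linarith)⟩
  have hK30 := hK31.le
  -- choice of l
  obtain ⟨l, hl1, hl2⟩ : ∃ l : ℝ, 1 ≤ l ∧ K1 + 2 * K2 + K3 ≤ 2 * l * (amin * ρ) := by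
    refine ⟨1 + (K1 + 2 * K2 + K3) / (2 * (amin * ρ)), ?_, ?_⟩
    · have : 0 ≤ (K1 + 2 * K2 + K3) / (2 * (amin * ρ)) := by positivity
      linarith
    · have hp : 0 < amin * ρ := by positivity
      field_simp
      nlinarith
  set v : (Fin d → ℝ) → ℝ := fun z => Real.exp (-l * sqd y z) with hv
  have hvC : ContDiff ℝ 2 v := (contDiff_const.mul (contDiff_sqd y)).exp
  set ε := g y / 2 with hε
  have hεpos : 0 < ε := by positivity
  set e0 := Real.exp (-l * R) with he0
  -- key sign of the operator on the barrier
  have key : ∀ z, ρ ≤ sqd y z → sqd y z ≤ R →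
      0 ≤ (1/2) * ∑ j, ∑ k, diffMat σ z α j k * pd2 v j k z + ∑ k, B k z * pd v k z
        - K3 * (v z - e0) := by
    intro z hz1 hz2
    have e1 : ∑ j, ∑ k, diffMat σ z α j k * pd2 v j k z
        = (4 * l ^ 2 * ((fun i => z i - y i) ⬝ᵥ (diffMat σ z α *ᵥ fun i => z i - y i))
          - 2 * l * ∑ j, diffMat σ z α j j) * v z := by
      obtain ⟨ξ, hξ⟩ : ∃ ξ : Fin d → ℝ, ∀ i, z i - y i = ξ i := ⟨_, fun _ => rfl⟩
      simp only [hv, pd2_barrier, dotProduct, mulVec, hξ]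
      rw [sub_mul, Finset.mul_sum, Finset.mul_sum, Finset.sum_mul, Finset.sum_mul,
        ← Finset.sum_sub_distrib (f := fun j => _) (g := fun j => _)]
      refine Finset.sum_congr rfl fun j _ => ?_
      simp only [sub_mul, mul_sub, Finset.sum_sub_distrib]
      congr 1
      · simp only [Finset.mul_sum, Finset.sum_mul]
        refine Finset.sum_congr rfl fun k _ => ?_
        ring
      · simp
        ring
    have e2 : ∑ k, B k z * pd v k z = -2 * l * (∑ k, B k z * (z k - y k)) * v z := by
      simp only [hv, pd_barrier]
      rw [Finset.mul_sum, Finset.sum_mul]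
      refine Finset.sum_congr rfl fun k _ => ?_
      ring
    have h1 := hell z fun i => z i - y i
    have h2 := hK1 z hz2
    have h3 := hK2 z hz2
    have hvp : 0 < v z := Real.exp_pos _
    have he0p : 0 < e0 := Real.exp_pos _
    rw [e1, e2]
    set X := (fun i => z i - y i) ⬝ᵥ (diffMat σ z α *ᵥ fun i => z i - y i)
    set T := ∑ j, diffMat σ z α j j
    set Y := ∑ k, B k z * (z k - y k)
    have h4 : amin * ρ ≤ X := le_trans (mul_le_mul_of_nonneg_left hz1 hamin.le) h1
    have h5 : T ≤ K1 := (le_abs_self _).trans h2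
    have h6 : Y ≤ K2 := (le_abs_self _).trans h3
    have h7 : 0 ≤ 2 * l ^ 2 * X - l * T - 2 * l * Y - K3 := by
      have : K1 + 2 * K2 + K3 ≤ 2 * l * X := hl2.trans (by nlinarith)
      have : l * (K1 + 2 * K2 + K3) ≤ l * (2 * l * X) :=
        mul_le_mul_of_nonneg_left this (by linarith)
      nlinarith
    nlinarith [mul_nonneg h7 hvp.le, mul_nonneg hK30 he0p.le]
  -- minimise u = g - ε (v - e0)
  set u : (Fin d → ℝ) → ℝ := fun z => g z - ε * v z with hu
  have huC : ContDiff ℝ 2 u := hg.sub (contDiff_const.mul hvC)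
  obtain ⟨z, hzK, hz⟩ := hK.exists_isMinOn ⟨x, by simp [hR]⟩ huC.continuous.continuousOn
  have hzK' : sqd y z ≤ R := hzK
  have huz : -(ε * e0) ≤ u z := by
    by_contra hlt
    push Not at hlt
    have he0p : 0 < e0 := Real.exp_pos _
    have hv1 : v z ≤ 1 := Real.exp_le_one_iff.2 (by nlinarith [hsq0 z])
    rcases lt_or_ge (sqd y z) ρ with h1 | h1
    · have := hball z h1.le
      have : ε * v z ≤ ε * 1 := mul_le_mul_of_nonneg_left hv1 hεpos.le
      simp only [hu] at hlt
      nlinarith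
    rcases eq_or_lt_of_le hzK' with h2 | h2
    · have h3 : v z = e0 := by simp only [hv, he0, h2]
      have := hg0 z
      simp only [hu, h3] at hlt
      nlinarith
    have hloc : IsLocalMin u z := by
      have : {z | sqd y z ≤ R} ∈ nhds z :=
        Filter.mem_of_superset ((isOpen_lt hsqc continuous_const).mem_nhds h2)
          (fun w (hw : sqd y w < R) => hw.le)
      exact hz.isLocalMin this
    have hA := diffusion_nonneg_of_min σ huC hloc α
    have hpd2 : ∀ j k, pd2 u j k z = pd2 g j k z - ε * pd2 v j k z := fun j k => by
      rw [hu, pd2_sub hg (contDiff_const.mul hvC), pd2_const_mul hvC]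
    have hpd : ∀ k, pd g k z = ε * pd v k z := fun k => by
      have h3 := pd_eq_zero_of_min hloc k
      rw [hu, pd_sub (hg.differentiable (by norm_num) z)
        ((hvC.differentiable (by norm_num) z).const_mul ε),
        pd_const_mul (hvC.differentiable (by norm_num) z)] at h3
      linarith
    have hA' : ∑ j, ∑ k, diffMat σ z α j k * pd2 u j k z =
      (∑ j, ∑ k, diffMat σ z α j k * pd2 g j k z)
        - ε * ∑ j, ∑ k, diffMat σ z α j k * pd2 v j k z := by
      simp only [hpd2, mul_sub, Finset.sum_sub_distrib, Finset.mul_sum]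
      congr 1
      refine Finset.sum_congr rfl fun j _ => Finset.sum_congr rfl fun k _ => ?_
      ring
    have hB' : ∑ k, B k z * pd g k z = ε * ∑ k, B k z * pd v k z := by
      simp only [hpd, Finset.mul_sum]
      refine Finset.sum_congr rfl fun j _ => ?_
      ring
    have hk := key z h1 hzK'
    have hi := hineq z
    have hc3 := (abs_le.1 (hK3 z hzK)).1
    have hgz := hg0 z
    rw [hB'] at hi
    rw [hA'] at hA
    simp only [hu] at hlt
    set P := ∑ j, ∑ k, diffMat σ z α j k * pd2 g j k z
    set V := ∑ j, ∑ k, diffMat σ z α j k * pd2 v j k z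
    set W := ∑ k, B k z * pd v k z
    have hk' := mul_le_mul_of_nonneg_left hk hεpos.le
    have h8 : 0 ≤ (c z + K3) * g z := mul_nonneg (by linarith) hgz
    nlinarith
  have hux : u z ≤ u x := hz (by simp [hR])
  have h9 : e0 < v x := Real.exp_lt_exp.2 (by nlinarith [hsq0 x])
  have : -(ε * e0) ≤ g x - ε * v x := huz.trans hux
  nlinarith


/-! ### Periodic functions -/

lemma per_box {d : ℕ} (x : Fin d → ℝ) :
    ∃ x' ∈ Set.Icc (0 : Fin d → ℝ) 1, ∀ f : (Fin d → ℝ) → ℝ, Per f → f x = f x' := by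
  refine ⟨fun i => Int.fract (x i), ⟨fun i => Int.fract_nonneg _, fun i =>
    (Int.fract_lt_one _).le⟩, fun f hf => ?_⟩
  have := hf (fun i => Int.fract (x i)) (fun i => ⌊x i⌋)
  rw [← this]
  congr 1
  funext i
  simp

lemma per_bounded {d : ℕ} {f : (Fin d → ℝ) → ℝ} (hf : Continuous f) (hp : Per f) :
    ∃ C, 0 ≤ C ∧ ∀ x, |f x| ≤ C := by
  obtain ⟨C, h0, hC⟩ := exists_bound_on (isCompact_Icc (a := (0 : Fin d → ℝ)) (b := 1)) hf
  refine ⟨C, h0, fun x => ?_⟩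
  obtain ⟨x', hx', h⟩ := per_box x
  rw [h f hp]
  exact hC x' hx'

lemma per_exists_min {d m : ℕ} (hm : 0 < m) (f : (Fin d → ℝ) → Fin m → ℝ)
    (hf : ∀ α, Continuous fun x => f x α) (hp : ∀ α, Per fun x => f x α) :
    ∃ x₀ α₀, ∀ x α, f x₀ α₀ ≤ f x α := by
  have : Nonempty (Fin m) := ⟨⟨0, hm⟩⟩
  have h1 : ∀ α, ∃ x₀, ∀ x, f x₀ α ≤ f x α := by
    intro α
    obtain ⟨x₀, _, hx₀⟩ := (isCompact_Icc (a := (0 : Fin d → ℝ)) (b := 1)).exists_isMinOn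
      ⟨0, by simp⟩ (hf α).continuousOn
    refine ⟨x₀, fun x => ?_⟩
    obtain ⟨x', hx', h⟩ := per_box x
    rw [h (fun x => f x α) (hp α)]
    exact hx₀ hx'
  choose p hp' using h1
  obtain ⟨α₀, hα₀⟩ := Finite.exists_min fun α => f (p α) α
  exact ⟨p α₀, α₀, fun x α => (hα₀ α).trans (hp' α x)⟩

/-! ### Nondivergence form of the adjoint -/

def adjB {d m : ℕ} (b : (Fin d → ℝ) → Fin m → Fin d → ℝ)
    (a : (Fin d → ℝ) → Fin m → Matrix (Fin d) (Fin d) ℝ) (α : Fin m) (k : Fin d)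
    (x : Fin d → ℝ) : ℝ :=
  -b x α k + (1/2) * ∑ j, (pd (fun y => a y α j k) j x + pd (fun y => a y α k j) j x)

def adjC {d m : ℕ} (b : (Fin d → ℝ) → Fin m → Fin d → ℝ)
    (a : (Fin d → ℝ) → Fin m → Matrix (Fin d) (Fin d) ℝ) (α : Fin m)
    (x : Fin d → ℝ) : ℝ :=
  -(∑ j, pd (fun y => b y α j) j x) + (1/2) * ∑ j, ∑ k, pd2 (fun y => a y α j k) j k x

lemma genAdj_expand {d m : ℕ} (b : (Fin d → ℝ) → Fin m → Fin d → ℝ)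
    (a : (Fin d → ℝ) → Fin m → Matrix (Fin d) (Fin d) ℝ)
    (q : Fin m → Fin m → (Fin d → ℝ) → ℝ)
    (g : (Fin d → ℝ) → Fin m → ℝ) (x : Fin d → ℝ) (α : Fin m)
    (hb : ∀ j, ContDiff ℝ 2 fun x => b x α j) (ha : ∀ j k, ContDiff ℝ 2 fun x => a x α j k)
    (hg : ContDiff ℝ 2 fun x => g x α) :
    genAdj b a q g x α = (1/2) * ∑ j, ∑ k, a x α j k * pd2 (fun y => g y α) j k x
      + ∑ k, adjB b a α k x * pd (fun y => g y α) k x + adjC b a α x * g x α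
      + ∑ β, q β α x * g x β := by
  unfold genAdj adjB adjC
  have e1 : ∑ j, pd (fun y => b y α j * g y α) j x
      = (∑ j, pd (fun y => b y α j) j x) * g x α + ∑ k, b x α k * pd (fun y => g y α) k x := by
    rw [Finset.sum_mul, ← Finset.sum_add_distrib]
    refine Finset.sum_congr rfl fun j _ => ?_
    exact pd_mul ((hb j).differentiable (by norm_num) x) (hg.differentiable (by norm_num) x) j
  have e2 : ∑ j, ∑ k, pd2 (fun y => a y α j k * g y α) j k x
      = (∑ j, ∑ k, pd2 (fun y => a y α j k) j k x) * g x α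
        + ∑ k, (∑ j, (pd (fun y => a y α j k) j x + pd (fun y => a y α k j) j x))
            * pd (fun y => g y α) k x
        + ∑ j, ∑ k, a x α j k * pd2 (fun y => g y α) j k x := by
    have e3 : ∑ k, (∑ j, (pd (fun y => a y α j k) j x + pd (fun y => a y α k j) j x))
            * pd (fun y => g y α) k x = ∑ j, ∑ k, (pd (fun y => a y α j k) j x *
              pd (fun y => g y α) k x + pd (fun y => a y α j k) k x * pd (fun y => g y α) j x) := by
      simp only [Finset.sum_add_distrib, Finset.sum_mul, add_mul]
      congr 1
      rw [Finset.sum_comm]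
    rw [e3]
    simp only [Finset.sum_mul, ← Finset.sum_add_distrib]
    refine Finset.sum_congr rfl fun j _ => Finset.sum_congr rfl fun k _ => ?_
    rw [pd2_mul (ha j k) hg]
    ring
  rw [e1, e2]
  simp only [add_mul, Finset.sum_add_distrib, neg_mul, Finset.sum_neg_distrib]
  have e4 : ∑ k, 1 / 2 * (∑ j, pd (fun y => a y α j k) j x + ∑ j, pd (fun y => a y α k j) j x)
        * pd (fun y => g y α) k x
      = 1 / 2 * ∑ k, (∑ j, pd (fun y => a y α j k) j x + ∑ j, pd (fun y => a y α k j) j x)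
        * pd (fun y => g y α) k x := by
    rw [Finset.mul_sum]
    refine Finset.sum_congr rfl fun k _ => ?_
    ring
  rw [e4]
  simp only [add_mul, Finset.sum_add_distrib]
  ring

lemma contDiff_diffMat {d r m : ℕ} {n : WithTop ℕ∞}
    {σ : (Fin d → ℝ) → Fin m → Matrix (Fin d) (Fin r) ℝ}
    {α : Fin m} (hσ : ∀ i j, ContDiff ℝ n fun x => σ x α i j) (j k : Fin d) :
    ContDiff ℝ n fun x => diffMat σ x α j k := by
  simp_rw [diffMat_apply]
  exact ContDiff.sum fun i _ => (hσ j i).mul (hσ k i)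

/-- A nonnegative solution which is positive somewhere is positive everywhere. -/
lemma strong_pos {d r m : ℕ}
    (b : (Fin d → ℝ) → Fin m → Fin d → ℝ)
    (σ : (Fin d → ℝ) → Fin m → Matrix (Fin d) (Fin r) ℝ)
    (q : Fin m → Fin m → (Fin d → ℝ) → ℝ)
    (amin : ℝ) (hamin : 0 < amin)
    (hb : ∀ α j, ContDiff ℝ 2 fun x => b x α j)
    (hσ : ∀ α i j, ContDiff ℝ 2 fun x => σ x α i j)
    (hell : ∀ (x ξ : Fin d → ℝ) (α : Fin m),
      amin * ∑ i, ξ i ^ 2 ≤ ξ ⬝ᵥ (diffMat σ x α *ᵥ ξ))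
    (hq_cont : ∀ α β, Continuous (q α β))
    (hq_nonneg : ∀ α β, α ≠ β → ∀ x, 0 ≤ q α β x)
    (hq_irred : ∀ (x : Fin d → ℝ) (B : Set (Fin m)), B.Nonempty → Bᶜ.Nonempty →
      ∃ α ∈ B, ∃ β ∈ Bᶜ, q α β x ≠ 0)
    (w : (Fin d → ℝ) → Fin m → ℝ) (hw0 : ∀ x α, 0 ≤ w x α)
    (hw : ∀ α, ContDiff ℝ 2 fun x => w x α)
    (hsol : ∀ x α, genAdj b (diffMat σ) q w x α = 0)
    (y : Fin d → ℝ) (α₀ : Fin m) (hy : 0 < w y α₀) (x : Fin d → ℝ) (α : Fin m) : 0 < w x α := by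
  have ha : ∀ α j k, ContDiff ℝ 2 fun x => diffMat σ x α j k := fun α j k =>
    contDiff_diffMat (hσ α) j k
  have hprop : ∀ α y, 0 < w y α → ∀ x, 0 < w x α := by
    intro α y hy x
    refine pos_propagate σ α amin hamin (fun i j => (hσ α i j).continuous)
      (fun x ξ => hell x ξ α) (fun x => w x α) (hw α) (fun x => hw0 x α)
      (adjB b (diffMat σ) α) ?_ (fun x => adjC b (diffMat σ) α x + q α α x) ?_ ?_ y hy x
    · intro k
      unfold adjB
      refine (hb α k).continuous.neg.add (continuous_const.mul
        (continuous_finsetSum _ fun j _ => ?_))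
      exact (contDiff_one_pd (ha α j k) j).continuous.add (contDiff_one_pd (ha α k j) j).continuous
    · refine Continuous.add ?_ (hq_cont α α)
      unfold adjC
      refine (continuous_finsetSum _ fun j _ => (contDiff_one_pd (hb α j) j).continuous).neg.add
        (continuous_const.mul (continuous_finsetSum _ fun j _ => continuous_finsetSum _ fun k _ =>
          continuous_pd2 (ha α j k) j k))
    · intro x
      have h := hsol x α
      rw [genAdj_expand b (diffMat σ) q w x α (hb α) (ha α) (hw α),
        ← Finset.add_sum_erase _ _ (Finset.mem_univ α)] at h
      have hs : 0 ≤ ∑ β ∈ univ.erase α, q β α x * w x β :=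
        Finset.sum_nonneg fun β hβ => mul_nonneg
          (hq_nonneg β α (Finset.ne_of_mem_erase hβ) x) (hw0 x β)
      linarith
  by_contra hneg
  have hz : ∀ x, w x α = 0 := by
    intro x'
    by_contra hne
    exact hneg (hprop α x' (lt_of_le_of_ne (hw0 x' α) (Ne.symm hne)) x)
  obtain ⟨γ, ⟨z, hz1⟩, β, hβ, hq⟩ := hq_irred x {α | ∃ y, 0 < w y α} ⟨α₀, y, hy⟩
    ⟨α, fun ⟨y, hy⟩ => by rw [hz y] at hy; exact lt_irrefl _ hy⟩
  have hβ0 : ∀ x, w x β = 0 := by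
    intro x'
    by_contra hne
    exact hβ ⟨x', lt_of_le_of_ne (hw0 x' β) (Ne.symm hne)⟩
  have h := hsol x β
  have hz' : (fun y => w y β) = fun _ => (0:ℝ) := funext hβ0
  have hγβ : γ ≠ β := by
    rintro rfl
    exact hβ ⟨z, hz1⟩
  have hpos : 0 < ∑ β', q β' β x * w x β' := by
    refine Finset.sum_pos' (fun β' _ => ?_) ⟨γ, Finset.mem_univ _, mul_pos
      (lt_of_le_of_ne (hq_nonneg γ β hγβ x) (Ne.symm hq)) (hprop γ z hz1 x)⟩
    by_cases hbb : β' = β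
    · rw [hbb, hβ0 x, mul_zero]
    · exact mul_nonneg (hq_nonneg β' β hbb x) (hw0 x β')
  rw [genAdj_expand b (diffMat σ) q w x β (hb β) (ha β) (hw β), hz', hβ0 x] at h
  have p0 : ∀ k, pd (fun _ : Fin d → ℝ => (0:ℝ)) k = fun _ => 0 := by
    intro k; funext x; simp [pd]
  have p1 : ∀ j k, pd2 (fun _ : Fin d → ℝ => (0:ℝ)) j k x = 0 := by
    intro j k; simp [pd2, p0]
  simp only [p0, p1, mul_zero, Finset.sum_const_zero, zero_add, add_zero] at h
  linarith

lemma tInt_const_mul {d : ℕ} (t : ℝ) (f : (Fin d → ℝ) → ℝ) :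
    (tInt fun x => t * f x) = t * tInt f := by
  unfold tInt
  exact integral_const_mul t f

lemma density_unique {d r m : ℕ} (hm : 0 < m)
    (b : (Fin d → ℝ) → Fin m → Fin d → ℝ)
    (σ : (Fin d → ℝ) → Fin m → Matrix (Fin d) (Fin r) ℝ)
    (q : Fin m → Fin m → (Fin d → ℝ) → ℝ)
    (amin : ℝ) (hamin : 0 < amin)
    (hb : ∀ α j, ContDiff ℝ 2 fun x => b x α j)
    (hσ : ∀ α i j, ContDiff ℝ 2 fun x => σ x α i j)
    (hell : ∀ (x ξ : Fin d → ℝ) (α : Fin m),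
      amin * ∑ i, ξ i ^ 2 ≤ ξ ⬝ᵥ (diffMat σ x α *ᵥ ξ))
    (hq_cont : ∀ α β, Continuous (q α β))
    (hq_nonneg : ∀ α β, α ≠ β → ∀ x, 0 ≤ q α β x)
    (hq_irred : ∀ (x : Fin d → ℝ) (B : Set (Fin m)), B.Nonempty → Bᶜ.Nonempty →
      ∃ α ∈ B, ∃ β ∈ Bᶜ, q α β x ≠ 0)
    (M N : (Fin d → ℝ) → Fin m → ℝ)
    (hM0 : ∀ x α, 0 ≤ M x α) (hN0 : ∀ x α, 0 ≤ N x α)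
    (hM : ∀ α, ContDiff ℝ 2 fun x => M x α) (hN : ∀ α, ContDiff ℝ 2 fun x => N x α)
    (hMp : ∀ α, Per fun x => M x α) (hNp : ∀ α, Per fun x => N x α)
    (hMs : ∀ x α, genAdj b (diffMat σ) q M x α = 0)
    (hNs : ∀ x α, genAdj b (diffMat σ) q N x α = 0)
    (hM1 : (∑ α, tInt fun x => M x α) = 1) (hN1 : (∑ α, tInt fun x => N x α) = 1) : M = N := by
  have ha : ∀ α j k, ContDiff ℝ 2 fun x => diffMat σ x α j k := fun α j k =>
    contDiff_diffMat (hσ α) j k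
  have hNpos : ∀ x α, 0 < N x α := by
    have hex : ∃ y α, 0 < N y α := by
      by_contra hne
      push Not at hne
      have : ∀ α, (fun x => N x α) = fun _ => (0:ℝ) := fun α => funext fun x =>
        le_antisymm (hne x α) (hN0 x α)
      simp [this, tInt] at hN1
    obtain ⟨y, α₀, hy⟩ := hex
    exact strong_pos b σ q amin hamin hb hσ hell hq_cont hq_nonneg hq_irred N hN0 hN hNs y α₀ hy
  obtain ⟨x₀, α₀, hmin⟩ := per_exists_min hm (fun x α => M x α / N x α)
    (fun α => (hM α).continuous.div (hN α).continuous fun x => (hNpos x α).ne')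
    (fun α x ν => by
      have h1 := hMp α x ν
      have h2 := hNp α x ν
      simp only at h1 h2 ⊢
      rw [h1, h2])
  set t := M x₀ α₀ / N x₀ α₀ with ht
  set w : (Fin d → ℝ) → Fin m → ℝ := fun x α => M x α - t * N x α with hw
  have hwC : ∀ α, ContDiff ℝ 2 fun x => w x α := fun α => (hM α).sub (contDiff_const.mul (hN α))
  have hw0 : ∀ x α, 0 ≤ w x α := by
    intro x α
    have := hmin x α
    rw [le_div_iff₀ (hNpos x α)] at this
    simp only [hw]
    linarith
  have hws : ∀ x α, genAdj b (diffMat σ) q w x α = 0 := by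
    intro x α
    have h1 := hMs x α
    have h2 := hNs x α
    rw [genAdj_expand b (diffMat σ) q _ x α (hb α) (ha α) (hM α)] at h1
    rw [genAdj_expand b (diffMat σ) q _ x α (hb α) (ha α) (hN α)] at h2
    rw [genAdj_expand b (diffMat σ) q _ x α (hb α) (ha α) (hwC α)]
    have e1 : ∀ k, pd (fun y => w y α) k x
        = pd (fun y => M y α) k x - t * pd (fun y => N y α) k x := by
      intro k
      rw [hw, pd_sub ((hM α).differentiable (by norm_num) x)
        (((hN α).differentiable (by norm_num) x).const_mul t),
        pd_const_mul ((hN α).differentiable (by norm_num) x)]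
    have e2 : ∀ j k, pd2 (fun y => w y α) j k x
        = pd2 (fun y => M y α) j k x - t * pd2 (fun y => N y α) j k x := by
      intro j k
      rw [hw, pd2_sub (hM α) (contDiff_const.mul (hN α)), pd2_const_mul (hN α)]
    have e3 : ∀ β, w x β = M x β - t * N x β := fun β => rfl
    simp only [e1, e2, e3]
    simp only [mul_sub, Finset.sum_sub_distrib, mul_left_comm _ t, ← Finset.mul_sum]
    linear_combination h1 - t * h2
  have hwz : w x₀ α₀ = 0 := by
    simp only [hw, ht]
    field_simp [(hNpos x₀ α₀).ne']
    simp
  have hwall : ∀ x α, w x α = 0 := by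
    intro x α
    by_contra hne
    have := strong_pos b σ q amin hamin hb hσ hell hq_cont hq_nonneg hq_irred w hw0 hwC hws x α
      (lt_of_le_of_ne (hw0 x α) (Ne.symm hne)) x₀ α₀
    linarith
  have hMN : ∀ x α, M x α = t * N x α := fun x α => by
    have := hwall x α
    simp only [hw] at this
    linarith
  have ht1 : t = 1 := by
    have : (∑ α, tInt fun x => M x α) = t * ∑ α, tInt fun x => N x α := by
      rw [Finset.mul_sum]
      refine Finset.sum_congr rfl fun α _ => ?_
      simp only [hMN]
      exact tInt_const_mul t _
    rw [hM1, hN1] at this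
    linarith
  funext x α
  rw [hMN, ht1, one_mul]


/-! ### The invariant functional, by Hahn-Banach -/

def bddSub (d m : ℕ) : Submodule ℝ ((Fin d → ℝ) → Fin m → ℝ) where
  carrier := {f | ∃ C, ∀ x α, |f x α| ≤ C}
  zero_mem' := ⟨0, by simp⟩
  add_mem' := by
    rintro f g ⟨C, hC⟩ ⟨D, hD⟩
    exact ⟨C + D, fun x α => (abs_add_le _ _).trans (add_le_add (hC x α) (hD x α))⟩
  smul_mem' := by
    rintro c f ⟨C, hC⟩
    refine ⟨|c| * C, fun x α => ?_⟩
    simp only [Pi.smul_apply, smul_eq_mul, abs_mul]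
    exact mul_le_mul_of_nonneg_left (hC x α) (abs_nonneg c)

/-- admissible test functions -/
def Test {d m : ℕ} (f : (Fin d → ℝ) → Fin m → ℝ) : Prop :=
  (∀ α, ContDiff ℝ 2 fun x => f x α) ∧ ∀ α, Per fun x => f x α

lemma gen_add {d m : ℕ} (b : (Fin d → ℝ) → Fin m → Fin d → ℝ)
    (a : (Fin d → ℝ) → Fin m → Matrix (Fin d) (Fin d) ℝ)
    (q : Fin m → Fin m → (Fin d → ℝ) → ℝ)
    (f g : (Fin d → ℝ) → Fin m → ℝ) (hf : Test f) (hg : Test g) (x : Fin d → ℝ) (α : Fin m) :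
    gen b a q (f + g) x α = gen b a q f x α + gen b a q g x α := by
  unfold gen jumpOp
  have e1 : ∀ j, pd (fun y => f y α + g y α) j x = pd (fun y => f y α) j x + pd (fun y => g y α) j x :=
    fun j => pd_add ((hf.1 α).differentiable (by norm_num) x)
      ((hg.1 α).differentiable (by norm_num) x) j
  have e2 : ∀ j k, pd2 (fun y => f y α + g y α) j k x
      = pd2 (fun y => f y α) j k x + pd2 (fun y => g y α) j k x :=
    fun j k => pd2_add (hf.1 α) (hg.1 α) j k x
  simp only [Pi.add_apply]
  simp only [e1, e2, mul_add, Finset.sum_add_distrib]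
  have e3 : ∑ β ∈ univ.filter (fun β => β ≠ α), q α β x * (f x β + g x β - (f x α + g x α))
      = ∑ β ∈ univ.filter (fun β => β ≠ α), q α β x * (f x β - f x α)
      + ∑ β ∈ univ.filter (fun β => β ≠ α), q α β x * (g x β - g x α) := by
    rw [← Finset.sum_add_distrib]
    refine Finset.sum_congr rfl fun β _ => ?_
    ring
  rw [e3]
  ring

lemma gen_smul {d m : ℕ} (b : (Fin d → ℝ) → Fin m → Fin d → ℝ)
    (a : (Fin d → ℝ) → Fin m → Matrix (Fin d) (Fin d) ℝ)
    (q : Fin m → Fin m → (Fin d → ℝ) → ℝ)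
    (c : ℝ) (f : (Fin d → ℝ) → Fin m → ℝ) (hf : Test f) (x : Fin d → ℝ) (α : Fin m) :
    gen b a q (c • f) x α = c * gen b a q f x α := by
  unfold gen jumpOp
  have e1 : ∀ j, pd (fun y => c * f y α) j x = c * pd (fun y => f y α) j x :=
    fun j => pd_const_mul ((hf.1 α).differentiable (by norm_num) x) c j
  have e2 : ∀ j k, pd2 (fun y => c * f y α) j k x = c * pd2 (fun y => f y α) j k x :=
    fun j k => pd2_const_mul (hf.1 α) c j k x
  simp only [Pi.smul_apply, smul_eq_mul]
  simp only [e1, e2, mul_add, Finset.mul_sum]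
  congr 1
  · congr 1
    · refine Finset.sum_congr rfl fun β _ => ?_
      ring
    · refine Finset.sum_congr rfl fun β _ => Finset.sum_congr rfl fun β _ => ?_
      ring
  · refine Finset.sum_congr rfl fun β _ => ?_
    ring

lemma Test.add {d m : ℕ} {f g : (Fin d → ℝ) → Fin m → ℝ} (hf : Test f) (hg : Test g) :
    Test (f + g) :=
  ⟨fun α => (hf.1 α).add (hg.1 α), fun α x ν => by
    have h1 := hf.2 α x ν
    have h2 := hg.2 α x ν
    simp only [Pi.add_apply] at h1 h2 ⊢
    rw [h1, h2]⟩

lemma Test.smul {d m : ℕ} {f : (Fin d → ℝ) → Fin m → ℝ} (c : ℝ) (hf : Test f) :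
    Test (c • f) :=
  ⟨fun α => contDiff_const.mul (hf.1 α), fun α x ν => by
    have h1 := hf.2 α x ν
    simp only [Pi.smul_apply] at h1 ⊢
    rw [h1]⟩

lemma Per.pd {d : ℕ} {f : (Fin d → ℝ) → ℝ} (hf : Per f) (j : Fin d) : Per (fun x => pd f j x) := by
  intro x ν
  unfold _root_.pd
  have h : (fun y => f (y + fun i => (ν i : ℝ))) = f := funext fun y => hf y ν
  have h2 := fderiv_comp_add_right (𝕜 := ℝ) (f := f) (x := x) (fun i => (ν i : ℝ))
  rw [h] at h2
  simp only [h2]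

lemma Per.mul {d : ℕ} {f g : (Fin d → ℝ) → ℝ} (hf : Per f) (hg : Per g) :
    Per (fun x => f x * g x) := fun x ν => by
  have h1 := hf x ν
  have h2 := hg x ν
  simp only at h1 h2 ⊢
  rw [h1, h2]

lemma Per.sum {d : ℕ} {ι : Type*} (s : Finset ι) {f : ι → (Fin d → ℝ) → ℝ}
    (hf : ∀ i ∈ s, Per (f i)) :
    Per (fun x => ∑ i ∈ s, f i x) := fun x ν =>
  Finset.sum_congr rfl fun i hi => hf i hi x ν

lemma Per.add {d : ℕ} {f g : (Fin d → ℝ) → ℝ} (hf : Per f) (hg : Per g) :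
    Per (fun x => f x + g x) := fun x ν => by
  have h1 := hf x ν
  have h2 := hg x ν
  simp only at h1 h2 ⊢
  rw [h1, h2]

lemma Per.sub {d : ℕ} {f g : (Fin d → ℝ) → ℝ} (hf : Per f) (hg : Per g) :
    Per (fun x => f x - g x) := fun x ν => by
  have h1 := hf x ν
  have h2 := hg x ν
  simp only at h1 h2 ⊢
  rw [h1, h2]

lemma Per.const {d : ℕ} (c : ℝ) : Per (fun _ : Fin d → ℝ => c) := fun _ _ => rfl

lemma per_diffMat {d r m : ℕ} {σ : (Fin d → ℝ) → Fin m → Matrix (Fin d) (Fin r) ℝ}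
    {α : Fin m} (hσ : ∀ i j, Per fun x => σ x α i j) (j k : Fin d) :
    Per fun x => diffMat σ x α j k := by
  simp_rw [diffMat_apply]
  exact Per.sum _ fun i _ => (hσ j i).mul (hσ k i)

lemma gen_bdd {d m : ℕ} (b : (Fin d → ℝ) → Fin m → Fin d → ℝ)
    (a : (Fin d → ℝ) → Fin m → Matrix (Fin d) (Fin d) ℝ)
    (q : Fin m → Fin m → (Fin d → ℝ) → ℝ)
    (hb : ∀ α j, Continuous fun x => b x α j) (ha : ∀ α i j, Continuous fun x => a x α i j)
    (hq : ∀ α β, Continuous (q α β))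
    (hb_per : ∀ α j, Per fun x => b x α j)
    (ha_per : ∀ α i j, Per fun x => a x α i j)
    (hq_per : ∀ α β, Per (q α β))
    (f : (Fin d → ℝ) → Fin m → ℝ) (hf : Test f) : ∃ C, ∀ x α, |gen b a q f x α| ≤ C := by
  have h1 : ∀ α, ∃ C, 0 ≤ C ∧ ∀ x, |gen b a q f x α| ≤ C := by
    intro α
    refine per_bounded (f := fun x => gen b a q f x α) ?_ ?_
    · unfold gen jumpOp
      refine ((continuous_finsetSum _ fun j _ => ?_).add (continuous_const.mul
        (continuous_finsetSum _ fun j _ => continuous_finsetSum _ fun k _ => ?_))).add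
        (continuous_finsetSum _ fun β _ => ?_)
      · exact (hb α j).mul (contDiff_one_pd (hf.1 α) j).continuous
      · exact (ha α j k).mul (continuous_pd2 (hf.1 α) j k)
      · exact (hq α β).mul ((hf.1 β).continuous.sub (hf.1 α).continuous)
    · unfold gen jumpOp
      refine Per.add (Per.add (Per.sum _ fun j _ => ?_) ((Per.const _).mul
        (Per.sum _ fun j _ => Per.sum _ fun k _ => ?_))) (Per.sum _ fun β _ => ?_)
      · exact (hb_per α j).mul ((hf.2 α).pd j)
      · exact (ha_per α j k).mul (((hf.2 α).pd j).pd k)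
      · exact (hq_per α β).mul ((hf.2 β).sub (hf.2 α))
  choose C hC0 hC using h1
  exact ⟨∑ α, C α, fun x α => (hC α x).trans
    (Finset.single_le_sum (f := C) (fun i _ => hC0 i) (Finset.mem_univ α))⟩

lemma gen_min_nonneg {d r m : ℕ} (hm : 0 < m) (b : (Fin d → ℝ) → Fin m → Fin d → ℝ)
    (σ : (Fin d → ℝ) → Fin m → Matrix (Fin d) (Fin r) ℝ)
    (q : Fin m → Fin m → (Fin d → ℝ) → ℝ)
    (hq_nonneg : ∀ α β, α ≠ β → ∀ x, 0 ≤ q α β x)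
    (f : (Fin d → ℝ) → Fin m → ℝ) (hf : Test f) : ∃ x α, 0 ≤ gen b (diffMat σ) q f x α := by
  obtain ⟨x, α, h⟩ := per_exists_min hm f (fun α => (hf.1 α).continuous) hf.2
  have hloc : IsLocalMin (fun y => f y α) x := Filter.Eventually.of_forall fun y => h y α
  refine ⟨x, α, ?_⟩
  unfold gen jumpOp
  have h1 := diffusion_nonneg_of_min σ (hf.1 α) hloc α
  have h2 : ∑ j, b x α j * pd (fun y => f y α) j x = 0 :=
    Finset.sum_eq_zero fun j _ => by rw [pd_eq_zero_of_min hloc j, mul_zero]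
  have h3 : 0 ≤ ∑ β ∈ univ.filter (fun β => β ≠ α), q α β x * (f x β - f x α) := by
    refine Finset.sum_nonneg fun β hβ => mul_nonneg ?_ (sub_nonneg.2 (h x β))
    exact hq_nonneg α β (Ne.symm (Finset.mem_filter.1 hβ).2) x
  rw [h2]
  linarith

lemma exists_functional {d r m : ℕ} (hm : 0 < m) (b : (Fin d → ℝ) → Fin m → Fin d → ℝ)
    (σ : (Fin d → ℝ) → Fin m → Matrix (Fin d) (Fin r) ℝ)
    (q : Fin m → Fin m → (Fin d → ℝ) → ℝ)
    (hb : ∀ α j, Continuous fun x => b x α j) (hσ : ∀ α i j, Continuous fun x => σ x α i j)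
    (hq : ∀ α β, Continuous (q α β))
    (hq_nonneg : ∀ α β, α ≠ β → ∀ x, 0 ≤ q α β x)
    (hb_per : ∀ α j, Per fun x => b x α j)
    (hσ_per : ∀ α i j, Per fun x => σ x α i j)
    (hq_per : ∀ α β, Per (q α β)) :
    ∃ μ : ((Fin d → ℝ) → Fin m → ℝ) →ₗ[ℝ] ℝ,
      (∀ f C, (∃ D, ∀ x α, |f x α| ≤ D) → (∀ x α, f x α ≤ C) → μ f ≤ C) ∧
      ∀ f, Test f → μ (gen b (diffMat σ) q f) = 0 := by
  have hbd : ∀ f, Test f → ∃ C, ∀ x α, |gen b (diffMat σ) q f x α| ≤ C := fun f hf =>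
    gen_bdd b (diffMat σ) q hb (fun α i j => by
      simp_rw [diffMat_apply]
      exact continuous_finsetSum _ fun k _ => (hσ α i k).mul (hσ α j k)) hq hb_per
      (fun α i j => per_diffMat (hσ_per α) i j) hq_per f hf
  set L := gen b (diffMat σ) q with hL
  set S : ((Fin d → ℝ) → Fin m → ℝ) → Set ℝ :=
    fun g => {C | ∃ f, Test f ∧ ∀ x α, g x α + L f x α ≤ C} with hS
  have hlow : ∀ g D, (∀ x α, -D ≤ g x α) → ∀ C ∈ S g, -D ≤ C := by
    rintro g D hD C ⟨f, hf, hC⟩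
    obtain ⟨x, α, hx⟩ := gen_min_nonneg hm b σ q hq_nonneg f hf
    have h1 := hC x α
    have h2 := hD x α
    have h3 : 0 ≤ L f x α := hx
    linarith
  have hbelow : ∀ g ∈ bddSub d m, BddBelow (S g) := by
    rintro g ⟨D, hD⟩
    exact ⟨-D, fun C hC => hlow g D (fun x α => (abs_le.1 (hD x α)).1) C hC⟩
  have hT0 : Test (0 : (Fin d → ℝ) → Fin m → ℝ) :=
    ⟨fun α => contDiff_const, fun α x ν => rfl⟩
  have hL0 : ∀ x α, L 0 x α = 0 := fun x α => by
    have := gen_smul b (diffMat σ) q 0 0 hT0 x α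
    simpa using this
  have hsimple : ∀ g C, (∀ x α, g x α ≤ C) → C ∈ S g := fun g C h =>
    ⟨0, hT0, fun x α => by rw [hL0]; linarith [h x α]⟩
  have hne : ∀ g ∈ bddSub d m, (S g).Nonempty := by
    rintro g ⟨D, hD⟩
    exact ⟨D, hsimple g D fun x α => (abs_le.1 (hD x α)).2⟩
  set N : bddSub d m → ℝ := fun g => sInf (S g.1) with hN
  have hScale : ∀ (c : ℝ), 0 < c → ∀ g : (Fin d → ℝ) → Fin m → ℝ, ∀ C ∈ S g, c * C ∈ S (c • g) := by
    rintro c hc g C ⟨f, hf, h⟩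
    refine ⟨c • f, hf.smul c, fun x α => ?_⟩
    rw [hL, gen_smul _ _ _ c f hf]
    simp only [Pi.smul_apply, smul_eq_mul]
    rw [← mul_add]
    exact mul_le_mul_of_nonneg_left (h x α) hc.le
  have hNle : ∀ (c : ℝ), 0 < c → ∀ g, c * N g ≤ N (c • g) := by
    intro c hc g
    refine le_csInf (hne _ (c • g).2) fun C hC => ?_
    have h1 := hScale c⁻¹ (inv_pos.2 hc) _ C hC
    have h2 : c⁻¹ • ((c • g : bddSub d m) : (Fin d → ℝ) → Fin m → ℝ) = g.1 := by
      simp [smul_smul, hc.ne']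
    rw [h2] at h1
    have h3 : N g ≤ c⁻¹ * C := csInf_le (hbelow _ g.2) h1
    calc c * N g ≤ c * (c⁻¹ * C) := mul_le_mul_of_nonneg_left h3 hc.le
      _ = C := by field_simp
  obtain ⟨μ₀, -, hμ₀⟩ := exists_extension_of_le_sublinear
    (⟨⊥, 0⟩ : bddSub d m →ₗ.[ℝ] ℝ) N (by
      intro c hc g
      refine le_antisymm ?_ (hNle c hc g)
      have h1 := hNle c⁻¹ (inv_pos.2 hc) (c • g)
      rw [smul_smul, inv_mul_cancel₀ hc.ne', one_smul] at h1
      rwa [inv_mul_le_iff₀ hc] at h1) (by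
      intro g h
      have : N (g + h) - N h ≤ N g := by
        refine le_csInf (hne _ g.2) ?_
        rintro C ⟨f, hf, hC⟩
        have : N (g + h) - C ≤ N h := by
          refine le_csInf (hne _ h.2) ?_
          rintro C' ⟨f', hf', hC'⟩
          have : N (g + h) ≤ C + C' := by
            refine csInf_le (hbelow _ (g + h).2) ⟨f + f', hf.add hf', fun x α => ?_⟩
            rw [hL, gen_add _ _ _ f f' hf hf']
            have h1 := hC x α
            have h2 := hC' x α
            simp only [Submodule.coe_add, Pi.add_apply]
            simp only [hL] at h1 h2
            linarith
          linarith
        linarith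
      linarith) (by
      rintro ⟨g, hg⟩
      have hg' : g = 0 := by simpa using hg
      subst hg'
      change (0:ℝ) ≤ N 0
      refine le_csInf (hne _ (0 : bddSub d m).2) fun C hC => ?_
      have := hlow (0 : (Fin d → ℝ) → Fin m → ℝ) 0 (fun x α => by simp) C hC
      simpa using this)
  obtain ⟨μ, hμ⟩ := LinearMap.exists_extend μ₀
  have hμ' : ∀ g (hg : g ∈ bddSub d m), μ g = μ₀ ⟨g, hg⟩ := fun g hg => by
    rw [← hμ]; rfl
  have hle : ∀ f, Test f → μ (L f) ≤ 0 := by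
    intro f hf
    rw [hμ' (L f) (hbd f hf)]
    refine (hμ₀ _).trans (csInf_le (hbelow _ (hbd f hf)) ⟨(-1 : ℝ) • f, hf.smul _, fun x α => ?_⟩)
    have h1 : L ((-1 : ℝ) • f) x α = -1 * L f x α := gen_smul b (diffMat σ) q (-1) f hf x α
    change L f x α + L ((-1 : ℝ) • f) x α ≤ 0
    rw [h1]
    linarith
  refine ⟨μ, fun f C hf hC => ?_, fun f hf => le_antisymm (hle f hf) ?_⟩
  · rw [hμ' f hf]
    exact (hμ₀ _).trans (csInf_le (hbelow f hf) (hsimple f C hC))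
  · have h1 := hle _ (hf.smul (-1))
    have h2 : L ((-1 : ℝ) • f) = (-1 : ℝ) • L f := by
      funext x α
      exact gen_smul b (diffMat σ) q (-1) f hf x α
    rw [h2, map_smul] at h1
    simp at h1
    exact h1


/-! ### Lattice weights and rapidly decreasing sequences -/

def NN {d : ℕ} (n : Fin d → ℤ) : ℝ := 1 + ∑ j, |(n j : ℝ)|

lemma NN_ge_one {d : ℕ} (n : Fin d → ℤ) : 1 ≤ NN n := by
  unfold NN
  have : 0 ≤ ∑ j, |(n j : ℝ)| := Finset.sum_nonneg fun j _ => abs_nonneg _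
  linarith

lemma NN_pos {d : ℕ} (n : Fin d → ℤ) : 0 < NN n := lt_of_lt_of_le one_pos (NN_ge_one n)

lemma abs_le_NN {d : ℕ} (n : Fin d → ℤ) (j : Fin d) : 1 + |(n j : ℝ)| ≤ NN n := by
  unfold NN
  have := Finset.single_le_sum (f := fun j => |(n j : ℝ)|) (fun i _ => abs_nonneg _)
    (Finset.mem_univ j)
  linarith

lemma NN_neg {d : ℕ} (n : Fin d → ℤ) : NN (-n) = NN n := by
  simp [NN]

/-- `NN k ≤ NN l + (NN (k - l) - 1)` -/
lemma NN_sub {d : ℕ} (k l : Fin d → ℤ) : NN k ≤ NN l + (NN (k - l) - 1) := by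
  unfold NN
  have : ∑ j, |(k j : ℝ)| ≤ ∑ j, |(l j : ℝ)| + ∑ j, |((k - l) j : ℝ)| := by
    rw [← Finset.sum_add_distrib]
    refine Finset.sum_le_sum fun j _ => ?_
    have : (k j : ℝ) = l j + ((k - l) j : ℤ) := by
      simp
    rw [this]
    exact abs_add_le _ _
  linarith

lemma NN_le_mul {d : ℕ} (k l : Fin d → ℤ) : NN k ≤ NN (k - l) * NN l := by
  have h1 := NN_sub k l
  have h2 := NN_ge_one l
  have h3 := NN_ge_one (k - l)
  nlinarith

lemma summable_prod_pi {d : ℕ} {f : ℤ → ℝ} (hf0 : ∀ n, 0 ≤ f n) (hf : Summable f) :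
    Summable (fun n : Fin d → ℤ => ∏ j, f (n j)) := by
  classical
  refine summable_of_sum_le (c := ∏ _j : Fin d, ∑' k, f k)
    (fun n => Finset.prod_nonneg fun j _ => hf0 _) fun s => ?_
  let t : Fin d → Finset ℤ := fun j => s.image fun n => n j
  calc ∑ n ∈ s, ∏ j, f (n j) ≤ ∑ n ∈ Fintype.piFinset t, ∏ j, f (n j) := by
        refine Finset.sum_le_sum_of_subset_of_nonneg (fun n hn => ?_)
          fun n _ _ => Finset.prod_nonneg fun j _ => hf0 _
        rw [Fintype.mem_piFinset]
        exact fun j => Finset.mem_image_of_mem _ hn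
    _ = ∏ j, ∑ k ∈ t j, f k := by rw [Finset.prod_univ_sum]
    _ ≤ ∏ _j : Fin d, ∑' k, f k :=
        Finset.prod_le_prod (fun j _ => Finset.sum_nonneg fun k _ => hf0 k)
          fun j _ => hf.sum_le_tsum _ fun k _ => hf0 k

lemma summable_int_sq : Summable (fun n : ℤ => ((1 + |(n : ℝ)|) ^ 2)⁻¹) := by
  have h : Summable (fun n : ℤ => 1 / |(n : ℝ) + 2⁻¹| ^ (2:ℝ)) :=
    Real.summable_one_div_int_add_rpow 2⁻¹ 2 |>.2 (by norm_num)
  refine Summable.of_nonneg_of_le (fun n => by positivity) (fun n => ?_) h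
  rw [← one_div]
  have h2 : |(n : ℝ) + 2⁻¹| ≤ 1 + |(n : ℝ)| := by
    refine (abs_add_le _ _).trans ?_
    rw [abs_of_pos (show (0:ℝ) < 2⁻¹ by norm_num)]
    linarith [abs_nonneg (n : ℝ)]
  have h3 : 0 < |(n : ℝ) + 2⁻¹| := by
    rw [abs_pos]
    intro h
    have h4 : ((2 * n + 1 : ℤ) : ℝ) = 0 := by push_cast; linarith
    have h5 : 2 * n + 1 = 0 := by exact_mod_cast h4
    omega
  rw [show ((2:ℝ)) = ((2:ℕ) : ℝ) by norm_num, Real.rpow_natCast]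
  exact one_div_le_one_div_of_le (by positivity) (pow_le_pow_left₀ h3.le h2 2)

lemma summable_NN (d : ℕ) : Summable (fun n : Fin d → ℤ => (NN n ^ (2 * d))⁻¹) := by
  refine Summable.of_nonneg_of_le (fun n => by have := NN_pos n; positivity) (fun n => ?_)
    (summable_prod_pi (d := d) (fun n => by positivity) summable_int_sq)
  rw [Finset.prod_inv_distrib]
  refine inv_anti₀ (Finset.prod_pos fun j _ => by positivity) ?_
  rw [pow_mul]
  calc ∏ j, (1 + |(n j : ℝ)|) ^ 2 ≤ ∏ _j : Fin d, NN n ^ 2 :=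
        Finset.prod_le_prod (fun j _ => by positivity)
          fun j _ => pow_le_pow_left₀ (by positivity) (abs_le_NN n j) 2
    _ = (NN n ^ 2) ^ d := by simp

/-- rapid decrease -/
def RD {d : ℕ} (c : (Fin d → ℤ) → ℂ) : Prop := ∀ p : ℕ, ∃ C : ℝ, ∀ n, ‖c n‖ * NN n ^ p ≤ C

lemma RD.summable {d : ℕ} {c : (Fin d → ℤ) → ℂ} (h : RD c) (p : ℕ) :
    Summable (fun n => ‖c n‖ * NN n ^ p) := by
  obtain ⟨C, hC⟩ := h (p + 2 * d)
  refine Summable.of_nonneg_of_le (fun n => by have := NN_pos n; positivity) (fun n => ?_)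
    ((summable_NN d).mul_left C)
  have := NN_pos n
  rw [← div_eq_mul_inv, le_div_iff₀ (by positivity), mul_assoc, ← pow_add]
  exact hC n

lemma RD.summable_norm {d : ℕ} {c : (Fin d → ℤ) → ℂ} (h : RD c) :
    Summable (fun n => ‖c n‖) := by
  simpa using h.summable 0

lemma RD.of_le {d : ℕ} {c c' : (Fin d → ℤ) → ℂ} (h : RD c) (hc : ∀ n, ‖c' n‖ ≤ ‖c n‖) : RD c' := by
  intro p
  obtain ⟨C, hC⟩ := h p
  refine ⟨C, fun n => le_trans ?_ (hC n)⟩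
  have := NN_pos n
  gcongr
  exact hc n

lemma RD.const_mul {d : ℕ} {c : (Fin d → ℤ) → ℂ} (h : RD c) (t : ℂ) : RD (fun n => t * c n) := by
  intro p
  obtain ⟨C, hC⟩ := h p
  refine ⟨‖t‖ * C, fun n => ?_⟩
  rw [norm_mul, mul_assoc]
  exact mul_le_mul_of_nonneg_left (hC n) (norm_nonneg _)

lemma RD.add {d : ℕ} {c c' : (Fin d → ℤ) → ℂ} (h : RD c) (h' : RD c') : RD (fun n => c n + c' n) := by
  intro p
  obtain ⟨C, hC⟩ := h p
  obtain ⟨C', hC'⟩ := h' p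
  refine ⟨C + C', fun n => ?_⟩
  have := NN_pos n
  calc ‖c n + c' n‖ * NN n ^ p ≤ (‖c n‖ + ‖c' n‖) * NN n ^ p := by
        gcongr; exact norm_add_le _ _
    _ ≤ C + C' := by rw [add_mul]; exact add_le_add (hC n) (hC' n)

lemma RD.mul_coord {d : ℕ} {c : (Fin d → ℤ) → ℂ} (h : RD c) (j : Fin d) :
    RD (fun n => (n j : ℂ) * c n) := by
  intro p
  obtain ⟨C, hC⟩ := h (p + 1)
  refine ⟨C, fun n => le_trans ?_ (hC n)⟩
  have h0 := NN_pos n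
  rw [norm_mul, pow_succ]
  have : ‖(n j : ℂ)‖ ≤ NN n := by
    rw [Complex.norm_intCast]; linarith [abs_le_NN n j]
  calc ‖(n j : ℂ)‖ * ‖c n‖ * NN n ^ p ≤ NN n * ‖c n‖ * NN n ^ p := by gcongr
    _ = _ := by ring

/-- convolution -/
def cv {d : ℕ} (c c' : (Fin d → ℤ) → ℂ) (k : Fin d → ℤ) : ℂ := ∑' l, c (k - l) * c' l

lemma RD.cv_summable {d : ℕ} {c c' : (Fin d → ℤ) → ℂ} (h : RD c) {B : ℝ} (h' : ∀ n, ‖c' n‖ ≤ B)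
    (k : Fin d → ℤ) : Summable (fun l => ‖c (k - l) * c' l‖) := by
  have h1 : Summable (fun l => ‖c (k - l)‖) := (Equiv.subLeft k).summable_iff.2 h.summable_norm
  refine Summable.of_nonneg_of_le (fun n => norm_nonneg _) (fun n => ?_) (h1.mul_right B)
  rw [norm_mul]
  exact mul_le_mul_of_nonneg_left (h' n) (norm_nonneg _)

lemma RD.bdd {d : ℕ} {c : (Fin d → ℤ) → ℂ} (h : RD c) : ∃ B, ∀ n, ‖c n‖ ≤ B := by
  obtain ⟨C, hC⟩ := h 0
  exact ⟨C, by simpa using hC⟩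

lemma RD.cv {d : ℕ} {c c' : (Fin d → ℤ) → ℂ} (h : RD c) (h' : RD c') : RD (cv c c') := by
  intro p
  obtain ⟨B, hB⟩ := h'.bdd
  obtain ⟨C, hC⟩ := h p
  have hs := (h'.summable p).mul_left C
  refine ⟨∑' l, C * (‖c' l‖ * NN l ^ p), fun k => ?_⟩
  have h0 := NN_pos k
  unfold _root_.cv
  calc ‖∑' l, c (k - l) * c' l‖ * NN k ^ p ≤ (∑' l, ‖c (k - l) * c' l‖) * NN k ^ p := by
        gcongr; exact norm_tsum_le_tsum_norm (h.cv_summable hB k)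
    _ = ∑' l, ‖c (k - l) * c' l‖ * NN k ^ p := by rw [tsum_mul_right]
    _ ≤ _ := by
        refine Summable.tsum_le_tsum (fun l => ?_) ((h.cv_summable hB k).mul_right _) hs
        have h1 := NN_pos l
        have h2 := NN_pos (k - l)
        rw [norm_mul]
        calc ‖c (k - l)‖ * ‖c' l‖ * NN k ^ p
            ≤ ‖c (k - l)‖ * ‖c' l‖ * (NN (k - l) * NN l) ^ p := by
              gcongr; exact NN_le_mul k l
          _ = (‖c (k - l)‖ * NN (k - l) ^ p) * (‖c' l‖ * NN l ^ p) := by rw [mul_pow]; ring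
          _ ≤ C * (‖c' l‖ * NN l ^ p) := by gcongr; exact hC _


/-! ### Fourier series on the torus -/

def ee {d : ℕ} (n : Fin d → ℤ) (x : Fin d → ℝ) : ℂ :=
  Complex.exp (2 * Real.pi * Complex.I * ∑ j, (n j : ℂ) * (x j : ℂ))

lemma ee_add {d : ℕ} (n k : Fin d → ℤ) (x : Fin d → ℝ) : ee (n + k) x = ee n x * ee k x := by
  unfold ee
  rw [← Complex.exp_add, ← mul_add, ← Finset.sum_add_distrib]
  congr 2
  refine Finset.sum_congr rfl fun j _ => ?_
  simp [add_mul]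

lemma ee_zero {d : ℕ} (x : Fin d → ℝ) : ee 0 x = 1 := by
  simp [ee]

lemma norm_ee {d : ℕ} (n : Fin d → ℤ) (x : Fin d → ℝ) : ‖ee n x‖ = 1 := by
  unfold ee
  have : (2 * Real.pi * Complex.I * ∑ j, (n j : ℂ) * (x j : ℂ))
      = ((2 * Real.pi * ∑ j, (n j : ℝ) * x j : ℝ) : ℂ) * Complex.I := by
    push_cast; ring
  rw [this, Complex.norm_exp_ofReal_mul_I]

lemma ee_neg {d : ℕ} (n : Fin d → ℤ) (x : Fin d → ℝ) : ee (-n) x = (starRingEnd ℂ) (ee n x) := by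
  unfold ee
  rw [← Complex.exp_conj]
  congr 1
  have h2 : (starRingEnd ℂ) 2 = 2 := Complex.conj_ofNat 2
  simp [map_sum, map_mul, h2]

lemma ee_per {d : ℕ} (n : Fin d → ℤ) (x : Fin d → ℝ) (ν : Fin d → ℤ) :
    ee n (x + fun i => (ν i : ℝ)) = ee n x := by
  unfold ee
  rw [Complex.exp_eq_exp_iff_exists_int]
  refine ⟨∑ j, n j * ν j, ?_⟩
  simp only [Pi.add_apply]
  push_cast
  simp only [mul_add, Finset.sum_add_distrib]
  ring

def eeD {d : ℕ} (n : Fin d → ℤ) : (Fin d → ℝ) →L[ℝ] ℂ :=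
  ∑ j, (ContinuousLinearMap.proj (R := ℝ) (φ := fun _ : Fin d => ℝ) j).smulRight
    (2 * Real.pi * Complex.I * (n j : ℂ))

lemma eeD_apply {d : ℕ} (n : Fin d → ℤ) (x : Fin d → ℝ) :
    eeD n x = 2 * Real.pi * Complex.I * ∑ j, (n j : ℂ) * (x j : ℂ) := by
  simp only [eeD, _root_.sum_apply, ContinuousLinearMap.smulRight_apply,
    ContinuousLinearMap.proj_apply, Complex.real_smul]
  rw [Finset.mul_sum]
  refine Finset.sum_congr rfl fun j _ => ?_
  ring

lemma eeD_single {d : ℕ} (n : Fin d → ℤ) (j : Fin d) :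
    eeD n (Pi.single j 1) = 2 * Real.pi * Complex.I * (n j : ℂ) := by
  rw [eeD_apply]
  congr 1
  rw [Finset.sum_eq_single j]
  · simp
  · intro b _ hb
    simp [Pi.single_eq_of_ne hb]
  · simp

lemma norm_eeD_le {d : ℕ} (n : Fin d → ℤ) : ‖eeD n‖ ≤ 2 * Real.pi * NN n := by
  have hpi := Real.pi_pos
  refine ContinuousLinearMap.opNorm_le_bound _ (by have := NN_pos n; positivity) fun x => ?_
  rw [eeD_apply, norm_mul]
  have h1 : ‖(2 * Real.pi * Complex.I : ℂ)‖ = 2 * Real.pi := by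
    simp [abs_of_pos hpi]
  rw [h1, mul_assoc (2 * Real.pi)]
  refine mul_le_mul_of_nonneg_left ?_ (by positivity : (0:ℝ) ≤ 2 * Real.pi)
  calc ‖∑ j, (n j : ℂ) * (x j : ℂ)‖ ≤ ∑ j, |(n j : ℝ)| * ‖x‖ := by
        refine norm_sum_le_of_le _ fun j _ => ?_
        rw [norm_mul, Complex.norm_intCast, Complex.norm_real]
        exact mul_le_mul_of_nonneg_left (norm_le_pi_norm x j) (abs_nonneg _)
    _ = (∑ j, |(n j : ℝ)|) * ‖x‖ := by rw [Finset.sum_mul]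
    _ ≤ NN n * ‖x‖ := by
        refine mul_le_mul_of_nonneg_right ?_ (norm_nonneg _)
        unfold NN; linarith

lemma hasFDerivAt_ee {d : ℕ} (n : Fin d → ℤ) (x : Fin d → ℝ) :
    HasFDerivAt (ee n) (ee n x • eeD n) x := by
  have h1 : HasFDerivAt (fun x => eeD n x) (eeD n) x := (eeD n).hasFDerivAt
  have h2 := h1.cexp
  have e : ee n = fun x => Complex.exp (eeD n x) := by
    funext y; rw [eeD_apply]; rfl
  rw [e]
  exact h2

lemma contDiff_ee {d : ℕ} {k : WithTop ℕ∞} (n : Fin d → ℤ) : ContDiff ℝ k (ee n) := by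
  have e : ee n = fun x => Complex.exp (eeD n x) := by
    funext y; rw [eeD_apply]; rfl
  rw [e]
  exact (eeD n).contDiff.cexp

lemma continuous_ee {d : ℕ} (n : Fin d → ℤ) : Continuous (ee n) :=
  (contDiff_ee (k := 0) n).continuous

def FS {d : ℕ} (c : (Fin d → ℤ) → ℂ) (x : Fin d → ℝ) : ℂ := ∑' n, c n * ee n x

lemma RD.fs_summable {d : ℕ} {c : (Fin d → ℤ) → ℂ} (h : RD c) (x : Fin d → ℝ) :
    Summable (fun n => ‖c n * ee n x‖) := by
  simpa [norm_ee] using h.summable_norm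

lemma RD.hasFDerivAt {d : ℕ} {c : (Fin d → ℤ) → ℂ} (h : RD c) (x : Fin d → ℝ) :
    HasFDerivAt (FS c) (∑ j, (ContinuousLinearMap.proj (R := ℝ) (φ := fun _ : Fin d => ℝ) j).smulRight
      (FS (fun n => 2 * Real.pi * Complex.I * ((n j : ℂ) * c n)) x)) x := by
  have hb : ∀ n (x : Fin d → ℝ), ‖c n • (ee n x • eeD n)‖ ≤ 2 * Real.pi * (‖c n‖ * NN n ^ 1) := by
    intro n x
    rw [norm_smul, norm_smul, norm_ee, one_mul, pow_one]
    have := norm_eeD_le n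
    calc ‖c n‖ * ‖eeD n‖ ≤ ‖c n‖ * (2 * Real.pi * NN n) := by gcongr
      _ = _ := by ring
  have hsum := (h.summable 1).mul_left (2 * Real.pi)
  have h1 := hasFDerivAt_tsum (𝕜 := ℝ) (f := fun n x => c n * ee n x)
    (f' := fun n x => c n • (ee n x • eeD n)) hsum
    (fun n x => (hasFDerivAt_ee n x).const_smul (c n)) hb (x₀ := 0) (h.fs_summable 0).of_norm x
  have hs : Summable (fun n => c n • (ee n x • eeD n)) :=
    Summable.of_norm_bounded hsum fun n => hb n x
  refine h1.congr_fderiv ?_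
  symm
  refine ContinuousLinearMap.ext fun v => ?_
  have e1 : (∑' n, c n • (ee n x • eeD n)) v = ∑' n, (c n • (ee n x • eeD n)) v := by
    have := (ContinuousLinearMap.apply ℝ ℂ v).map_tsum hs
    simpa using this
  rw [e1]
  simp only [_root_.sum_apply, ContinuousLinearMap.smulRight_apply,
    ContinuousLinearMap.proj_apply, _root_.smul_apply, smul_eq_mul, eeD_apply]
  have e2 : ∀ n, c n * (ee n x * (2 * Real.pi * Complex.I * ∑ j, (n j : ℂ) * (v j : ℂ)))
      = ∑ j, (v j : ℂ) * (2 * Real.pi * Complex.I * ((n j : ℂ) * c n) * ee n x) := by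
    intro n
    simp only [Finset.mul_sum]
    refine Finset.sum_congr rfl fun j _ => ?_
    ring
  simp_rw [e2]
  rw [Summable.tsum_finsetSum]
  · refine Finset.sum_congr rfl fun j _ => ?_
    rw [tsum_mul_left, Complex.real_smul]
    rfl
  · intro j _
    exact (((h.mul_coord j).const_mul _).fs_summable x).of_norm.mul_left _

lemma RD.deriv {d : ℕ} {c : (Fin d → ℤ) → ℂ} (h : RD c) (x : Fin d → ℝ) (j : Fin d) :
    fderiv ℝ (FS c) x (Pi.single j 1)
      = FS (fun n => 2 * Real.pi * Complex.I * ((n j : ℂ) * c n)) x := by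
  rw [(h.hasFDerivAt x).fderiv]
  simp only [_root_.sum_apply, ContinuousLinearMap.smulRight_apply,
    ContinuousLinearMap.proj_apply]
  rw [Finset.sum_eq_single j]
  · simp
  · intro b _ hb
    simp [Pi.single_eq_of_ne hb]
  · simp

lemma RD.contDiff_nat {d : ℕ} (k : ℕ) : ∀ {c : (Fin d → ℤ) → ℂ}, RD c → ContDiff ℝ k (FS c) := by
  induction k with
  | zero =>
    intro c h
    rw [Nat.cast_zero, contDiff_zero]
    exact continuous_iff_continuousAt.2 fun x => (h.hasFDerivAt x).continuousAt
  | succ k ih =>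
    intro c h
    rw [Nat.cast_succ, contDiff_succ_iff_hasFDerivAt]
    refine ⟨_, ?_, h.hasFDerivAt⟩
    refine ContDiff.sum fun j _ => ?_
    exact contDiff_const.smulRight (ih ((h.mul_coord j).const_mul _))

lemma RD.contDiff {d : ℕ} {c : (Fin d → ℤ) → ℂ} (h : RD c) : ContDiff ℝ (⊤ : ℕ∞) (FS c) :=
  contDiff_infty.2 fun k => h.contDiff_nat k

lemma RD.continuous {d : ℕ} {c : (Fin d → ℤ) → ℂ} (h : RD c) : Continuous (FS c) :=
  h.contDiff.continuous

lemma FS_per {d : ℕ} (c : (Fin d → ℤ) → ℂ) (x : Fin d → ℝ) (ν : Fin d → ℤ) :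
    FS c (x + fun i => (ν i : ℝ)) = FS c x := by
  unfold FS
  simp_rw [ee_per]

lemma FS_add {d : ℕ} {c c' : (Fin d → ℤ) → ℂ} (h : RD c) (h' : RD c') (x : Fin d → ℝ) :
    FS (fun n => c n + c' n) x = FS c x + FS c' x := by
  unfold FS
  rw [← (h.fs_summable x).of_norm.tsum_add (h'.fs_summable x).of_norm]
  simp_rw [add_mul]

lemma FS_const_mul {d : ℕ} (t : ℂ) (c : (Fin d → ℤ) → ℂ) (x : Fin d → ℝ) :
    FS (fun n => t * c n) x = t * FS c x := by
  unfold FS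
  rw [← tsum_mul_left]
  simp_rw [mul_assoc]

lemma RD.sum {d : ℕ} {ι : Type*} (s : Finset ι) {c : ι → (Fin d → ℤ) → ℂ} (h : ∀ i, RD (c i)) :
    RD (fun n => ∑ i ∈ s, c i n) := by
  classical
  induction s using Finset.induction_on with
  | empty =>
    intro p
    exact ⟨0, by simp⟩
  | insert i s hi ih =>
    simp only [Finset.sum_insert hi]
    exact (h i).add ih

lemma FS_sum {d : ℕ} {ι : Type*} (s : Finset ι) {c : ι → (Fin d → ℤ) → ℂ} (h : ∀ i, RD (c i))
    (x : Fin d → ℝ) :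
    FS (fun n => ∑ i ∈ s, c i n) x = ∑ i ∈ s, FS (c i) x := by
  unfold FS
  rw [← Summable.tsum_finsetSum fun i _ => ((h i).fs_summable x).of_norm]
  simp_rw [Finset.sum_mul]

lemma FS_mul {d : ℕ} {c c' : (Fin d → ℤ) → ℂ} (h : RD c) (h' : RD c') (x : Fin d → ℝ) :
    FS c x * FS c' x = FS (cv c c') x := by
  unfold FS
  rw [tsum_mul_tsum_of_summable_norm (h.fs_summable x) (h'.fs_summable x)]
  let e : (Fin d → ℤ) × (Fin d → ℤ) ≃ (Fin d → ℤ) × (Fin d → ℤ) :=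
    { toFun := fun p => (p.1 - p.2, p.2)
      invFun := fun p => (p.1 + p.2, p.2)
      left_inv := fun p => by simp
      right_inv := fun p => by simp }
  rw [← e.tsum_eq]
  have hs : Summable (fun p : (Fin d → ℤ) × (Fin d → ℤ) =>
      c (e p).1 * ee (e p).1 x * (c' (e p).2 * ee (e p).2 x)) :=
    e.summable_iff.2 (summable_mul_of_summable_norm (h.fs_summable x) (h'.fs_summable x))
  rw [hs.tsum_prod]
  refine tsum_congr fun k => ?_
  unfold cv
  rw [← tsum_mul_right]
  refine tsum_congr fun l => ?_
  change c (k - l) * ee (k - l) x * (c' l * ee l x) = _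
  have : ee k x = ee (k - l) x * ee l x := by rw [← ee_add, sub_add_cancel]
  rw [this]; ring


/-! ### Integrals over the box, Fourier coefficients -/

def bx (d : ℕ) : Set (Fin d → ℝ) := Set.pi Set.univ (fun _ : Fin d => Set.Ico (0:ℝ) 1)

lemma bx_ae (d : ℕ) : bx d =ᵐ[volume] Set.Icc (0 : Fin d → ℝ) 1 := by
  have := Measure.univ_pi_Ico_ae_eq_Icc (μ := fun _ : Fin d => (volume : Measure ℝ))
    (f := (0 : Fin d → ℝ)) (g := 1)
  exact this

lemma bx_meas (d : ℕ) : MeasurableSet (bx d) :=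
  MeasurableSet.univ_pi fun _ => measurableSet_Ico

lemma bx_vol (d : ℕ) : volume (bx d) = 1 := by
  unfold bx
  rw [Real.volume_pi_Ico]
  simp

instance bx_fin (d : ℕ) : IsFiniteMeasure (volume.restrict (bx d)) :=
  ⟨by rw [Measure.restrict_apply_univ, bx_vol]; exact ENNReal.one_lt_top⟩

lemma bx_integrable {d : ℕ} {E : Type*} [NormedAddCommGroup E] {f : (Fin d → ℝ) → E}
    (hf : Continuous f) : IntegrableOn f (bx d) := by
  have h1 : IntegrableOn f (Set.Icc (0 : Fin d → ℝ) 1) := hf.continuousOn.integrableOn_compact isCompact_Icc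
  exact h1.congr_set_ae (bx_ae d)

lemma int_const_bx {d : ℕ} (c : ℂ) : ∫ _x in bx d, c = c := by
  rw [setIntegral_const]
  simp [Measure.real, bx_vol]

lemma int_deriv_zero {d : ℕ} {F : (Fin d → ℝ) → ℂ} (hF : ContDiff ℝ 1 F)
    (hp : ∀ x (ν : Fin d → ℤ), F (x + fun i => (ν i : ℝ)) = F x) (j : Fin d) :
    ∫ x in bx d, fderiv ℝ F x (Pi.single j 1) = 0 := by
  rw [setIntegral_congr_set (bx_ae d)]
  obtain _ | n := d
  · exact j.elim0
  classical
  have hdiff := hF.differentiable (by norm_num)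
  have hcont : Continuous fun x => fderiv ℝ F x (Pi.single j 1) :=
    (hF.continuous_fderiv (by norm_num)).clm_apply continuous_const
  have hsum : ∀ x, ∑ i, (if i = j then fderiv ℝ F x else 0) (Pi.single i 1)
      = fderiv ℝ F x (Pi.single j 1) := by
    intro x
    rw [Finset.sum_eq_single j]
    · simp
    · intro b _ hb; simp [hb]
    · simp
  have key := integral_divergence_of_hasFDerivAt_off_countable' (E := ℂ) (0 : Fin (n+1) → ℝ) 1
    (fun _ => zero_le_one) (fun i => if i = j then F else 0)
    (fun i x => if i = j then fderiv ℝ F x else 0) ∅ Set.countable_empty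
    (fun i => by
      split_ifs
      · exact hF.continuous.continuousOn
      · exact continuousOn_const)
    (fun x _ i => by
      split_ifs
      · exact (hdiff x).hasFDerivAt
      · exact hasFDerivAt_const _ _)
    (by
      simp only [hsum]
      exact hcont.continuousOn.integrableOn_compact isCompact_Icc)
  simp only [hsum] at key
  rw [key]
  refine Finset.sum_eq_zero fun i _ => ?_
  rw [sub_eq_zero]
  congr 1
  funext x
  split_ifs with h
  · have h2 := hp (i.insertNth ((0 : Fin (n+1) → ℝ) i) x) (Pi.single i 1)
    rw [← h2]
    congr 1
    funext k
    refine Fin.succAboveCases i ?_ (fun k => ?_) k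
    · simp
    · simp
  · rfl

lemma int_ee {d : ℕ} (n : Fin d → ℤ) : ∫ x in bx d, ee n x = if n = 0 then 1 else 0 := by
  split_ifs with h
  · subst h
    simp_rw [ee_zero]
    exact int_const_bx 1
  · obtain ⟨j, hj⟩ := Function.ne_iff.1 h
    have h1 := int_deriv_zero (contDiff_ee (k := 1) n) (ee_per n) j
    have h2 : ∀ x, fderiv ℝ (ee n) x (Pi.single j 1) = (2 * Real.pi * Complex.I * (n j : ℂ)) * ee n x := by
      intro x
      rw [(hasFDerivAt_ee n x).fderiv, _root_.smul_apply, eeD_single, smul_eq_mul, mul_comm]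
    simp_rw [h2] at h1
    rw [integral_const_mul] at h1
    have h3 : (2 * Real.pi * Complex.I * (n j : ℂ)) ≠ 0 := by
      have : (n j : ℂ) ≠ 0 := by
        simpa using hj
      have h4 : (Real.pi : ℂ) ≠ 0 := by exact_mod_cast Real.pi_ne_zero
      simp [this, h4]
    exact (mul_eq_zero.1 h1).resolve_left h3

lemma int_FS {d : ℕ} {c : (Fin d → ℤ) → ℂ} (h : RD c) : ∫ x in bx d, FS c x = c 0 := by
  unfold FS
  have h1 := hasSum_integral_of_summable_integral_norm (μ := volume.restrict (bx d))
    (F := fun n x => c n * ee n x)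
    (fun n => bx_integrable (continuous_const.mul (continuous_ee n))) (by
      simp_rw [norm_mul, norm_ee, mul_one]
      simp only [integral_const, smul_eq_mul]
      exact h.summable_norm.mul_left _)
  have h2 : (fun n : Fin d → ℤ => ∫ x in bx d, c n * ee n x) = fun n => if n = 0 then c 0 else 0 := by
    funext n
    rw [integral_const_mul, int_ee]
    split_ifs with h
    · rw [h, mul_one]
    · rw [mul_zero]
  rw [h2] at h1
  exact h1.unique (hasSum_ite_eq 0 (c 0))

def fc {d : ℕ} (g : (Fin d → ℝ) → ℝ) (n : Fin d → ℤ) : ℂ := ∫ x in bx d, (g x : ℂ) * ee (-n) x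

lemma ofReal_fderiv {d : ℕ} {g : (Fin d → ℝ) → ℝ} {x : Fin d → ℝ} (hg : DifferentiableAt ℝ g x) :
    HasFDerivAt (fun y => (g y : ℂ)) (Complex.ofRealCLM.comp (fderiv ℝ g x)) x :=
  (Complex.ofRealCLM.hasFDerivAt (x := g x)).comp x hg.hasFDerivAt

lemma fc_pd {d : ℕ} {g : (Fin d → ℝ) → ℝ} (hg : ContDiff ℝ 1 g) (hp : Per g) (j : Fin d)
    (n : Fin d → ℤ) :
    fc (fun x => pd g j x) n = 2 * Real.pi * Complex.I * ((n j : ℂ) * fc g n) := by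
  have hG : ContDiff ℝ 1 (fun x => (g x : ℂ) * ee (-n) x) :=
    (Complex.ofRealCLM.contDiff.comp hg).mul (contDiff_ee _)
  have h1 := int_deriv_zero hG (fun x ν => by rw [ee_per, hp x ν]) j
  have hcg : Continuous fun x => (pd g j x : ℂ) := Complex.continuous_ofReal.comp
    (contDiff_pd (n := 0) hg (by norm_num) j).continuous
  have h2 : ∀ x, fderiv ℝ (fun x => (g x : ℂ) * ee (-n) x) x (Pi.single j 1)
      = (pd g j x : ℂ) * ee (-n) x
        - (2 * Real.pi * Complex.I * (n j : ℂ)) * ((g x : ℂ) * ee (-n) x) := by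
    intro x
    rw [((ofReal_fderiv (hg.differentiable (by norm_num) x)).fun_mul (hasFDerivAt_ee (-n) x)).fderiv]
    simp only [_root_.add_apply, _root_.smul_apply, eeD_single, smul_eq_mul,
      ContinuousLinearMap.comp_apply, Complex.ofRealCLM_apply, Pi.neg_apply]
    unfold pd
    push_cast
    ring
  simp_rw [h2] at h1
  rw [integral_sub, integral_const_mul, sub_eq_zero] at h1
  · unfold fc
    rw [h1]; ring
  · exact bx_integrable (hcg.mul (continuous_ee _))
  · exact bx_integrable (continuous_const.mul
      ((Complex.continuous_ofReal.comp hg.continuous).mul (continuous_ee _)))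

lemma fc_bdd {d : ℕ} {g : (Fin d → ℝ) → ℝ} (hg : Continuous g) (hp : Per g) :
    ∃ C, ∀ n, ‖fc g n‖ ≤ C := by
  obtain ⟨C, -, hC⟩ := per_bounded hg hp
  refine ⟨C, fun n => ?_⟩
  have h1 := norm_setIntegral_le_of_norm_le_const (μ := volume) (s := bx d) (C := C)
    (f := fun x => (g x : ℂ) * ee (-n) x) (by rw [bx_vol]; exact ENNReal.one_lt_top)
    (fun x _ => by rw [norm_mul, norm_ee, mul_one, Complex.norm_real]; exact hC x)
  unfold fc
  simpa [Measure.real, bx_vol] using h1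

lemma fc_RD {d : ℕ} (p : ℕ) : ∀ {g : (Fin d → ℝ) → ℝ}, ContDiff ℝ (⊤ : ℕ∞) g → Per g →
    ∃ C, ∀ n, ‖fc g n‖ * NN n ^ p ≤ C := by
  induction p with
  | zero =>
    intro g hg hp
    simpa using fc_bdd hg.continuous hp
  | succ p ih =>
    intro g hg hp
    obtain ⟨C, hC⟩ := ih hg hp
    have h1 : ∀ j, ∃ C, ∀ n, ‖fc (fun x => pd g j x) n‖ * NN n ^ p ≤ C := fun j =>
      ih (contDiff_pd hg (by exact_mod_cast le_top) j) (hp.pd j)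
    choose D hD using h1
    refine ⟨C + ∑ j, D j, fun n => ?_⟩
    have h0 := NN_pos n
    have h2 : ∀ j, |(n j : ℝ)| * (‖fc g n‖ * NN n ^ p) ≤ D j := by
      intro j
      refine le_trans ?_ (hD j n)
      rw [fc_pd (hg.of_le (by exact_mod_cast le_top)) hp, norm_mul, norm_mul (n j : ℂ), Complex.norm_intCast]
      have h3 : ‖(2 * Real.pi * Complex.I : ℂ)‖ = 2 * Real.pi := by
        simp [abs_of_pos Real.pi_pos]
      rw [h3, ← mul_assoc]
      have h4 : 0 ≤ |(n j : ℝ)| * ‖fc g n‖ * NN n ^ p := by positivity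
      nlinarith [Real.pi_gt_three]
    calc ‖fc g n‖ * NN n ^ (p + 1)
        = ‖fc g n‖ * NN n ^ p + ∑ j, |(n j : ℝ)| * (‖fc g n‖ * NN n ^ p) := by
          rw [← Finset.sum_mul, pow_succ]
          conv_lhs => rw [show NN n = 1 + ∑ j, |(n j : ℝ)| from rfl]
          rw [show (1 + ∑ j, |(n j : ℝ)|) = NN n from rfl]
          have : NN n = 1 + ∑ j, |(n j : ℝ)| := rfl
          linear_combination ‖fc g n‖ * NN n ^ p * this
      _ ≤ C + ∑ j, D j := add_le_add (hC n) (Finset.sum_le_sum fun j _ => h2 j)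

lemma RD_fc {d : ℕ} {g : (Fin d → ℝ) → ℝ} (hg : ContDiff ℝ (⊤ : ℕ∞) g) (hp : Per g) : RD (fc g) :=
  fun p => fc_RD p hg hp


/-! ### Fourier inversion -/

lemma mFourier_coe {d : ℕ} (n : Fin d → ℤ) (x : Fin d → ℝ) :
    UnitAddTorus.mFourier n (fun i => (x i : UnitAddCircle)) = ee n x := by
  simp only [UnitAddTorus.mFourier, ContinuousMap.coe_mk, fourier_coe_apply]
  rw [← Complex.exp_sum]
  unfold ee
  congr 1
  rw [Finset.mul_sum]
  refine Finset.sum_congr rfl fun j _ => ?_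
  push_cast
  ring

lemma FS_fc {d : ℕ} {g : (Fin d → ℝ) → ℝ} (hg : ContDiff ℝ (⊤ : ℕ∞) g) (hp : Per g)
    (x : Fin d → ℝ) : FS (fc g) x = g x := by
  have hq : IsOpenQuotientMap (fun (x : Fin d → ℝ) (i : Fin d) => (x i : UnitAddCircle)) :=
    IsOpenQuotientMap.piMap (f := fun (_ : Fin d) (t : ℝ) => (t : UnitAddCircle))
      fun _ => QuotientAddGroup.isOpenQuotientMap_mk
  let gc : C(Fin d → ℝ, ℂ) := ⟨fun x => (g x : ℂ), Complex.continuous_ofReal.comp hg.continuous⟩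
  have hfac : Function.FactorsThrough gc
      (fun (x : Fin d → ℝ) (i : Fin d) => (x i : UnitAddCircle)) := by
    intro x y hxy
    have h1 : ∀ i, ∃ k : ℤ, x i = y i + k := by
      intro i
      have := congrFun hxy i
      have h2 : ((x i - y i : ℝ) : UnitAddCircle) = 0 := by
        rw [AddCircle.coe_sub, sub_eq_zero]
        exact this
      obtain ⟨k, hk⟩ := (AddCircle.coe_eq_zero_iff (1:ℝ)).1 h2
      refine ⟨k, ?_⟩
      simp only [zsmul_eq_mul, mul_one] at hk
      linarith
    choose k hk using h1
    have : x = y + fun i => (k i : ℝ) := funext hk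
    change (g x : ℂ) = g y
    rw [this, hp y k]
  let pr : C(Fin d → ℝ, UnitAddTorus (Fin d)) :=
    ⟨fun (x : Fin d → ℝ) (i : Fin d) => (x i : UnitAddCircle), hq.continuous⟩
  have hpr : Topology.IsQuotientMap pr := hq.isQuotientMap
  let G : C(UnitAddTorus (Fin d), ℂ) := hpr.lift gc hfac
  have hG : ∀ x : Fin d → ℝ, G (fun i => (x i : UnitAddCircle)) = g x := by
    intro x
    have := hpr.lift_comp gc hfac
    exact congrArg (fun f => f x) this
  have hco : ∀ n, UnitAddTorus.mFourierCoeff G n = fc g n := by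
    intro n
    rw [UnitAddTorus.mFourierCoeff_eq_integral G n 0]
    unfold fc
    have hs : {x : Fin d → ℝ | ∀ i, x i ∈ Set.Ioc ((0 : Fin d → ℝ) i) ((0 : Fin d → ℝ) i + 1)}
        =ᵐ[volume] bx d := by
      refine Filter.EventuallyEq.trans ?_ (bx_ae d).symm
      have := Measure.univ_pi_Ioc_ae_eq_Icc (μ := fun _ : Fin d => (volume : Measure ℝ))
        (f := (0 : Fin d → ℝ)) (g := 1)
      refine Filter.EventuallyEq.trans (Filter.EventuallyEq.of_eq ?_) this
      change {x : Fin d → ℝ | _} = Set.pi _ _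
      ext x
      simp [Set.mem_pi]
    rw [setIntegral_congr_set hs]
    simp_rw [mFourier_coe, hG, smul_eq_mul, mul_comm]
  have hsum : Summable (UnitAddTorus.mFourierCoeff G) := by
    rw [show UnitAddTorus.mFourierCoeff G = fc g from funext hco]
    exact (RD_fc hg hp).summable_norm.of_norm
  have h := UnitAddTorus.hasSum_mFourier_series_apply_of_summable hsum (fun i => (x i : UnitAddCircle))
  simp_rw [hco, mFourier_coe, hG, smul_eq_mul] at h
  exact h.tsum_eq


/-! ### Moderate weights -/

structure ModW {d : ℕ} (C : ℝ) (p : ℕ) (w : (Fin d → ℤ) → ℝ) : Prop where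
  C0 : 0 ≤ C
  pos : ∀ k, 0 < w k
  le : ∀ k l, NN l * |w k - w l| ≤ C * NN (k - l) ^ p * w l

lemma ModW.le1 {d : ℕ} {C : ℝ} {p : ℕ} {w : (Fin d → ℤ) → ℝ} (h : ModW C p w) (k l : Fin d → ℤ) :
    w k ≤ (C + 1) * NN (k - l) ^ p * w l := by
  have h1 := h.le k l
  have h2 := NN_ge_one l
  have h3 : (1:ℝ) ≤ NN (k - l) ^ p := one_le_pow₀ (NN_ge_one _)
  have h4 := h.pos l
  have h5 : |w k - w l| ≤ NN l * |w k - w l| := le_mul_of_one_le_left (abs_nonneg _) h2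
  have h6 := le_abs_self (w k - w l)
  have h7 : w l ≤ NN (k - l) ^ p * w l := le_mul_of_one_le_left h4.le h3
  nlinarith

lemma ModW.mul {d : ℕ} {C C' : ℝ} {p p' : ℕ} {w w' : (Fin d → ℤ) → ℝ} (h : ModW C p w)
    (h' : ModW C' p' w') : ModW (C * (C' + 1) + C') (p + p') (fun k => w k * w' k) where
  C0 := by have := h.C0; have := h'.C0; positivity
  pos k := mul_pos (h.pos k) (h'.pos k)
  le k l := by
    have c0 := h.C0
    have c0' := h'.C0
    have hN := NN_pos l
    have hp : (1:ℝ) ≤ NN (k - l) ^ p := one_le_pow₀ (NN_ge_one _)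
    have hp' : (0:ℝ) < NN (k - l) ^ p' := pow_pos (NN_pos _) _
    have w0 := h.pos l
    have w0' := h'.pos l
    have e : w k * w' k - w l * w' l = (w k - w l) * w' k + w l * (w' k - w' l) := by ring
    have h1 : |w k * w' k - w l * w' l| ≤ |w k - w l| * w' k + w l * |w' k - w' l| := by
      rw [e]
      refine (abs_add_le _ _).trans (le_of_eq ?_)
      rw [abs_mul, abs_mul, abs_of_pos (h'.pos k), abs_of_pos w0]
    calc NN l * |w k * w' k - w l * w' l|
        ≤ NN l * (|w k - w l| * w' k + w l * |w' k - w' l|) := by gcongr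
      _ = (NN l * |w k - w l|) * w' k + w l * (NN l * |w' k - w' l|) := by ring
      _ ≤ (C * NN (k - l) ^ p * w l) * ((C' + 1) * NN (k - l) ^ p' * w' l)
          + w l * (C' * NN (k - l) ^ p' * w' l) := by
          have := h'.pos k
          have hpos := pow_pos (NN_pos (k - l)) p
          exact add_le_add (mul_le_mul (h.le k l) (h'.le1 k l) this.le (by positivity))
            (mul_le_mul_of_nonneg_left (h'.le k l) w0.le)
      _ ≤ (C * NN (k - l) ^ p * w l) * ((C' + 1) * NN (k - l) ^ p' * w' l)
          + NN (k - l) ^ p * (w l * (C' * NN (k - l) ^ p' * w' l)) := by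
          exact add_le_add le_rfl (le_mul_of_one_le_left (by positivity) hp)
      _ = _ := by rw [pow_add]; ring

lemma ModW.inv {d : ℕ} {C : ℝ} {p : ℕ} {w : (Fin d → ℤ) → ℝ} (h : ModW C p w) :
    ModW (C * (C + 1)) (p + p) (fun k => (w k)⁻¹) where
  C0 := by have := h.C0; positivity
  pos k := inv_pos.2 (h.pos k)
  le k l := by
    have c0 := h.C0
    have wk := h.pos k
    have wl := h.pos l
    have hN := NN_pos (k - l)
    have h1 := h.le k l
    have h2 := h.le1 l k
    rw [show NN (l - k) = NN (k - l) by rw [← NN_neg]; simp] at h2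
    have e : (w k)⁻¹ - (w l)⁻¹ = -((w k - w l) / (w k * w l)) := by field_simp; ring
    rw [e, abs_neg, abs_div, abs_of_pos (mul_pos wk wl), ← mul_div_assoc, div_le_iff₀ (by positivity)]
    calc NN l * |w k - w l| ≤ C * NN (k - l) ^ p * w l := h1
      _ ≤ C * NN (k - l) ^ p * ((C + 1) * NN (k - l) ^ p * w k) := by gcongr
      _ = _ := by rw [pow_add]; field_simp

lemma abs_NN_sub {d : ℕ} (k l : Fin d → ℤ) : |NN k - NN l| ≤ NN (k - l) := by
  have h1 := NN_sub k l
  have h2 := NN_sub l k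
  rw [show NN (l - k) = NN (k - l) by rw [← NN_neg]; simp] at h2
  rw [abs_le]
  constructor <;> linarith

lemma mod_NN {d : ℕ} : ModW 1 1 (NN (d := d)) where
  C0 := zero_le_one
  pos := NN_pos
  le k l := by
    have := abs_NN_sub k l
    have h := NN_pos l
    rw [one_mul, pow_one, mul_comm]
    gcongr

lemma mod_eps {d : ℕ} {ε : ℝ} (hε : 0 < ε) : ModW 1 1 (fun k : Fin d → ℤ => 1 + ε * NN k) where
  C0 := zero_le_one
  pos k := by have := NN_pos k; positivity
  le k l := by
    have := abs_NN_sub k l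
    have h := NN_pos l
    have h' := NN_pos (k - l)
    rw [one_mul, pow_one, show 1 + ε * NN k - (1 + ε * NN l) = ε * (NN k - NN l) by ring, abs_mul,
      abs_of_pos hε]
    calc NN l * (ε * |NN k - NN l|) ≤ NN l * (ε * NN (k - l)) := by gcongr
      _ ≤ _ := by nlinarith

lemma mod_one {d : ℕ} : ModW 0 0 (fun _ : Fin d → ℤ => (1:ℝ)) where
  C0 := le_rfl
  pos _ := one_pos
  le k l := by simp

lemma mod_pow {d : ℕ} (n : ℕ) : ∃ C p, ModW C p (fun k : Fin d → ℤ => NN k ^ n) := by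
  induction n with
  | zero => exact ⟨0, 0, by simpa using mod_one⟩
  | succ n ih =>
    obtain ⟨C, p, h⟩ := ih
    exact ⟨_, _, by simpa only [pow_succ] using h.mul mod_NN⟩

lemma mod_zpow {d : ℕ} (s : ℤ) : ∃ C p, ModW C p (fun k : Fin d → ℤ => NN k ^ s) := by
  obtain n | n := s
  · obtain ⟨C, p, h⟩ := mod_pow (d := d) n
    exact ⟨C, p, by simpa using h⟩
  · obtain ⟨C, p, h⟩ := mod_pow (d := d) (n + 1)
    exact ⟨_, _, by simpa only [zpow_negSucc] using h.inv⟩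

def wt {d : ℕ} (s : ℤ) (ε : ℝ) (k : Fin d → ℤ) : ℝ := NN k ^ s * (1 + ε * NN k)⁻¹

lemma mod_wt {d : ℕ} (s : ℤ) : ∃ C p, ∀ ε : ℝ, 0 < ε → ModW C p (wt (d := d) s ε) := by
  obtain ⟨C, p, h⟩ := mod_zpow (d := d) s
  exact ⟨_, _, fun ε hε => h.mul (mod_eps hε).inv⟩

lemma ModW.coord {d : ℕ} {C : ℝ} {p : ℕ} {w : (Fin d → ℤ) → ℝ} (h : ModW C p w) (k l : Fin d → ℤ)
    (j : Fin d) : |(k j : ℝ) * w k - l j * w l| ≤ (2 * C + 1) * NN (k - l) ^ (p + 1) * w l := by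
  have c0 := h.C0
  have wk := h.pos k
  have wl := h.pos l
  have hN := NN_ge_one (k - l)
  have e : (k j : ℝ) * w k - l j * w l = ((k - l) j : ℤ) * w k + l j * (w k - w l) := by
    simp; ring
  have h1 : |(((k - l) j : ℤ) : ℝ)| ≤ NN (k - l) := by linarith [abs_le_NN (k - l) j]
  have h2 : |(l j : ℝ)| ≤ NN l := by linarith [abs_le_NN l j]
  have hp : 0 < NN (k - l) ^ p := pow_pos (NN_pos _) _
  calc |(k j : ℝ) * w k - l j * w l| ≤ |(((k - l) j : ℤ) : ℝ)| * w k + |(l j : ℝ)| * |w k - w l| := by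
        rw [e]
        refine (abs_add_le _ _).trans (le_of_eq ?_)
        rw [abs_mul, abs_mul, abs_of_pos wk]
    _ ≤ NN (k - l) * ((C + 1) * NN (k - l) ^ p * w l) + NN l * |w k - w l| := by
        exact add_le_add (mul_le_mul h1 (h.le1 k l) wk.le (NN_pos _).le)
          (mul_le_mul_of_nonneg_right h2 (abs_nonneg _))
    _ ≤ NN (k - l) * ((C + 1) * NN (k - l) ^ p * w l) + C * NN (k - l) ^ p * w l := by
        exact add_le_add le_rfl (h.le k l)
    _ ≤ NN (k - l) * ((C + 1) * NN (k - l) ^ p * w l) + NN (k - l) * (C * NN (k - l) ^ p * w l) := by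
        exact add_le_add le_rfl (le_mul_of_one_le_left (by positivity) hN)
    _ = _ := by rw [pow_succ]; ring

/-! ### Young inequality -/

def shearE (d : ℕ) : (Fin d → ℤ) × (Fin d → ℤ) ≃ (Fin d → ℤ) × (Fin d → ℤ) where
  toFun p := (p.1 - p.2, p.1)
  invFun p := (p.2, p.2 - p.1)
  left_inv p := by simp
  right_inv p := by simp

def shearF (d : ℕ) : (Fin d → ℤ) × (Fin d → ℤ) ≃ (Fin d → ℤ) × (Fin d → ℤ) where
  toFun p := (p.1 - p.2, p.2)
  invFun p := (p.1 + p.2, p.2)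
  left_inv p := by simp
  right_inv p := by simp

lemma young {d : ℕ} {D f g : (Fin d → ℤ) → ℝ} (hD0 : ∀ k, 0 ≤ D k) (hD : Summable D)
    (hf : Summable fun k => f k ^ 2) (hg : Summable fun k => g k ^ 2)
    (hf0 : ∀ k, 0 ≤ f k) (hg0 : ∀ k, 0 ≤ g k) {δ : ℝ} (hδ : 0 < δ) :
    Summable (fun p : (Fin d → ℤ) × (Fin d → ℤ) => D (p.1 - p.2) * (f p.1 * g p.2)) ∧
    ∑' p : (Fin d → ℤ) × (Fin d → ℤ), D (p.1 - p.2) * (f p.1 * g p.2)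
      ≤ (∑' k, D k) * (δ * ∑' k, f k ^ 2 + δ⁻¹ * ∑' k, g k ^ 2) := by
  have h1 : HasSum (fun p : (Fin d → ℤ) × (Fin d → ℤ) => D (p.1 - p.2) * f p.1 ^ 2)
      ((∑' k, D k) * ∑' k, f k ^ 2) := by
    have hs := hD.mul_of_nonneg hf hD0 fun k => sq_nonneg _
    have := hs.hasSum
    rw [← hD.tsum_mul_tsum hf hs] at this
    exact (shearE d).hasSum_iff.2 this
  have h2 : HasSum (fun p : (Fin d → ℤ) × (Fin d → ℤ) => D (p.1 - p.2) * g p.2 ^ 2)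
      ((∑' k, D k) * ∑' k, g k ^ 2) := by
    have hs := hD.mul_of_nonneg hg hD0 fun k => sq_nonneg _
    have := hs.hasSum
    rw [← hD.tsum_mul_tsum hg hs] at this
    exact (shearF d).hasSum_iff.2 this
  have h3 := (h1.mul_left δ).add (h2.mul_left δ⁻¹)
  have hle : ∀ p : (Fin d → ℤ) × (Fin d → ℤ), D (p.1 - p.2) * (f p.1 * g p.2)
      ≤ δ * (D (p.1 - p.2) * f p.1 ^ 2) + δ⁻¹ * (D (p.1 - p.2) * g p.2 ^ 2) := by
    intro p
    have h4 : f p.1 * g p.2 ≤ δ * f p.1 ^ 2 + δ⁻¹ * g p.2 ^ 2 := by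
      have h5 : 0 ≤ δ⁻¹ * (δ * f p.1 - g p.2) ^ 2 := by positivity
      have h6 : δ⁻¹ * (δ * f p.1 - g p.2) ^ 2
          = δ * f p.1 ^ 2 + δ⁻¹ * g p.2 ^ 2 - 2 * (f p.1 * g p.2) := by
        field_simp; ring
      have h7 := mul_nonneg (hf0 p.1) (hg0 p.2)
      linarith
    calc D (p.1 - p.2) * (f p.1 * g p.2) ≤ D (p.1 - p.2) * (δ * f p.1 ^ 2 + δ⁻¹ * g p.2 ^ 2) :=
          mul_le_mul_of_nonneg_left h4 (hD0 _)
      _ = _ := by ring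
  have hs : Summable (fun p : (Fin d → ℤ) × (Fin d → ℤ) => D (p.1 - p.2) * (f p.1 * g p.2)) :=
    Summable.of_nonneg_of_le (fun p => mul_nonneg (hD0 _) (mul_nonneg (hf0 _) (hg0 _))) hle h3.summable
  refine ⟨hs, (hs.tsum_le_tsum hle h3.summable).trans (le_of_eq ?_)⟩
  rw [h3.tsum_eq]
  ring


/-! ### Ellipticity on the Fourier side -/

def trig {d : ℕ} (F : Finset (Fin d → ℤ)) (z : (Fin d → ℤ) → ℂ) (x : Fin d → ℝ) : ℂ :=
  ∑ l ∈ F, z l * ee l x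

lemma continuous_trig {d : ℕ} (F : Finset (Fin d → ℤ)) (z : (Fin d → ℤ) → ℂ) :
    Continuous (trig F z) :=
  continuous_finsetSum _ fun l _ => continuous_const.mul (continuous_ee l)

lemma int_trig {d : ℕ} (F : Finset (Fin d → ℤ)) (z w : (Fin d → ℤ) → ℂ) {g : (Fin d → ℝ) → ℝ}
    (hg : Continuous g) :
    ∫ x in bx d, (starRingEnd ℂ) (trig F z x) * (g x : ℂ) * trig F w x
      = ∑ k ∈ F, ∑ l ∈ F, (starRingEnd ℂ) (z k) * fc g (k - l) * w l := by
  have e : ∀ x, (starRingEnd ℂ) (trig F z x) * (g x : ℂ) * trig F w x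
      = ∑ k ∈ F, ∑ l ∈ F, ((starRingEnd ℂ) (z k) * w l) * ((g x : ℂ) * ee (-(k - l)) x) := by
    intro x
    unfold trig
    rw [map_sum, Finset.sum_mul, Finset.sum_mul]
    refine Finset.sum_congr rfl fun k _ => ?_
    rw [Finset.mul_sum]
    refine Finset.sum_congr rfl fun l _ => ?_
    rw [show -(k - l) = -k + l by abel, ee_add, ee_neg, map_mul]
    ring
  have hi : ∀ n : Fin d → ℤ, IntegrableOn (fun x => (g x : ℂ) * ee n x) (bx d) := fun n =>
    bx_integrable ((Complex.continuous_ofReal.comp hg).mul (continuous_ee n))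
  simp_rw [e]
  rw [integral_finsetSum _ fun k _ => integrable_finsetSum _ fun l _ => (hi _).const_mul _]
  refine Finset.sum_congr rfl fun k _ => ?_
  rw [integral_finsetSum _ fun l _ => (hi _).const_mul _]
  refine Finset.sum_congr rfl fun l _ => ?_
  rw [integral_const_mul, fc]
  ring

lemma fc_one {d : ℕ} (n : Fin d → ℤ) : fc (fun _ => (1:ℝ)) n = if n = 0 then 1 else 0 := by
  rw [fc]
  simp only [Complex.ofReal_one, one_mul]
  rw [int_ee]
  simp

lemma int_trig_sq {d : ℕ} (F : Finset (Fin d → ℤ)) (z : (Fin d → ℤ) → ℂ) :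
    ∫ x in bx d, (starRingEnd ℂ) (trig F z x) * ((1:ℝ) : ℂ) * trig F z x
      = ((∑ k ∈ F, ‖z k‖ ^ 2 : ℝ) : ℂ) := by
  rw [int_trig F z z (g := fun _ => (1:ℝ)) continuous_const]
  push_cast
  refine Finset.sum_congr rfl fun k hk => ?_
  simp only [fc_one, sub_eq_zero]
  simp [hk, Complex.conj_mul']

lemma ell_pt {d : ℕ} {A : Fin d → Fin d → ℝ} {c : ℝ}
    (h : ∀ ξ : Fin d → ℝ, c * ∑ i, ξ i ^ 2 ≤ ∑ i, ∑ j, ξ i * A i j * ξ j) (ζ : Fin d → ℂ) :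
    0 ≤ (∑ i, ∑ j, (starRingEnd ℂ) (ζ i) * (A i j : ℂ) * ζ j
      - c * ∑ i, (starRingEnd ℂ) (ζ i) * ((1:ℝ):ℂ) * ζ i).re := by
  have h1 := h fun i => (ζ i).re
  have h2 := h fun i => (ζ i).im
  rw [Complex.sub_re, Complex.re_ofReal_mul, Complex.re_sum, Complex.re_sum]
  have e1 : ∀ i, (∑ j, (starRingEnd ℂ) (ζ i) * (A i j : ℂ) * ζ j).re
      = ∑ j, (ζ i).re * A i j * (ζ j).re + ∑ j, (ζ i).im * A i j * (ζ j).im := by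
    intro i
    rw [Complex.re_sum, ← Finset.sum_add_distrib]
    refine Finset.sum_congr rfl fun j _ => ?_
    simp
  have e2 : ∀ i, ((starRingEnd ℂ) (ζ i) * ((1:ℝ):ℂ) * ζ i).re = (ζ i).re ^ 2 + (ζ i).im ^ 2 := by
    intro i
    simp
    ring
  simp only [e1, e2, Finset.sum_add_distrib]
  linarith

lemma ell_finite {d : ℕ} {a : Fin d → Fin d → (Fin d → ℝ) → ℝ} {c : ℝ}
    (ha : ∀ i j, Continuous (a i j))
    (h : ∀ x (ξ : Fin d → ℝ), c * ∑ i, ξ i ^ 2 ≤ ∑ i, ∑ j, ξ i * a i j x * ξ j)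
    (F : Finset (Fin d → ℤ)) (z : Fin d → (Fin d → ℤ) → ℂ) :
    c * ∑ i, ∑ k ∈ F, ‖z i k‖ ^ 2
      ≤ (∑ i, ∑ j, ∑ k ∈ F, ∑ l ∈ F,
          (starRingEnd ℂ) (z i k) * fc (a i j) (k - l) * z j l).re := by
  have hc : ∀ (g : (Fin d → ℝ) → ℝ), Continuous g → ∀ i j,
      IntegrableOn (fun x => (starRingEnd ℂ) (trig F (z i) x) * (g x : ℂ) * trig F (z j) x) (bx d) := by
    intro g hg i j
    exact bx_integrable (((Complex.continuous_conj.comp (continuous_trig F _)).mul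
      (Complex.continuous_ofReal.comp hg)).mul (continuous_trig F _))
  have hc1 := fun i => hc (fun _ => 1) continuous_const i i
  have key : 0 ≤ (∫ x in bx d, (∑ i, ∑ j, (starRingEnd ℂ) (trig F (z i) x) * (a i j x : ℂ)
      * trig F (z j) x - c * ∑ i, (starRingEnd ℂ) (trig F (z i) x) * ((1:ℝ):ℂ) * trig F (z i) x)).re := by
    have hIntg : IntegrableOn (fun x => (∑ i, ∑ j, (starRingEnd ℂ) (trig F (z i) x) * (a i j x : ℂ)
      * trig F (z j) x - c * ∑ i, (starRingEnd ℂ) (trig F (z i) x) * ((1:ℝ):ℂ) * trig F (z i) x)) (bx d) :=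
      (integrable_finsetSum _ fun i _ => integrable_finsetSum _ fun j _ => hc _ (ha i j) i j).sub
        ((integrable_finsetSum _ fun i _ => hc1 i).const_mul _)
    have := integral_re hIntg
    simp only [RCLike.re_to_complex] at this
    rw [← this]
    exact integral_nonneg fun x => ell_pt (h x) _
  rw [integral_sub (integrable_finsetSum _ fun i _ => integrable_finsetSum _ fun j _ =>
    hc _ (ha i j) i j) ((integrable_finsetSum _ fun i _ => hc1 i).const_mul _),
    integral_const_mul, integral_finsetSum _ fun i _ => integrable_finsetSum _ fun j _ =>
    hc _ (ha i j) i j, integral_finsetSum _ fun i _ => hc1 i] at key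
  have e1 : ∀ i, ∫ x in bx d, ∑ j, (starRingEnd ℂ) (trig F (z i) x) * (a i j x : ℂ) * trig F (z j) x
      = ∑ j, ∑ k ∈ F, ∑ l ∈ F, (starRingEnd ℂ) (z i k) * fc (a i j) (k - l) * z j l := by
    intro i
    rw [integral_finsetSum _ fun j _ => hc _ (ha i j) i j]
    exact Finset.sum_congr rfl fun j _ => int_trig F _ _ (ha i j)
  simp only [e1, int_trig_sq] at key
  simp only [Complex.sub_re, Complex.re_ofReal_mul, Complex.re_sum, Complex.ofReal_re] at key ⊢
  linarith


def EllF {d : ℕ} (c : ℝ) (A : Fin d → Fin d → (Fin d → ℤ) → ℂ) : Prop :=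
  ∀ (F : Finset (Fin d → ℤ)) (z : Fin d → (Fin d → ℤ) → ℂ),
    c * ∑ i, ∑ k ∈ F, ‖z i k‖ ^ 2
      ≤ (∑ i, ∑ j, ∑ k ∈ F, ∑ l ∈ F, (starRingEnd ℂ) (z i k) * A i j (k - l) * z j l).re

lemma ell_inf {d : ℕ} {c : ℝ} {A : Fin d → Fin d → (Fin d → ℤ) → ℂ} (hE : EllF c A)
    (hA : ∀ i j, RD (A i j)) {z : Fin d → (Fin d → ℤ) → ℂ}
    (hz : ∀ i, Summable fun k => ‖z i k‖ ^ 2) :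
    Summable (fun p : (Fin d → ℤ) × (Fin d → ℤ) =>
      ∑ i, ∑ j, (starRingEnd ℂ) (z i p.1) * A i j (p.1 - p.2) * z j p.2) ∧
    c * ∑ i, ∑' k, ‖z i k‖ ^ 2 ≤ (∑' p : (Fin d → ℤ) × (Fin d → ℤ),
      ∑ i, ∑ j, (starRingEnd ℂ) (z i p.1) * A i j (p.1 - p.2) * z j p.2).re := by
  have hs : ∀ i j, Summable (fun p : (Fin d → ℤ) × (Fin d → ℤ) =>
      (starRingEnd ℂ) (z i p.1) * A i j (p.1 - p.2) * z j p.2) := by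
    intro i j
    have := (young (fun k => norm_nonneg (A i j k)) (hA i j).summable_norm (hz i) (hz j)
      (fun k => norm_nonneg _) (fun k => norm_nonneg _) one_pos).1
    refine Summable.of_norm_bounded this fun p => le_of_eq ?_
    rw [norm_mul, norm_mul, RCLike.norm_conj]
    ring
  have hS := summable_sum (s := univ) fun i (_ : i ∈ univ) =>
    summable_sum (s := univ) fun j (_ : j ∈ univ) => hs i j
  refine ⟨hS, ?_⟩
  have t1 : Filter.Tendsto (fun F : Finset (Fin d → ℤ) => c * ∑ i, ∑ k ∈ F, ‖z i k‖ ^ 2)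
      Filter.atTop (nhds (c * ∑ i, ∑' k, ‖z i k‖ ^ 2)) :=
    (tendsto_finsetSum _ fun i _ => (hz i).hasSum).const_mul c
  have hd : Filter.Tendsto (fun F : Finset (Fin d → ℤ) => F ×ˢ F) Filter.atTop Filter.atTop :=
    Filter.tendsto_finsetProd_atTop.comp Filter.tendsto_atTop_diagonal
  have t2 := (Complex.continuous_re.tendsto _).comp (hS.hasSum.comp hd)
  refine le_of_tendsto_of_tendsto' t1 t2 fun F => (hE F z).trans (le_of_eq ?_)
  simp only [Function.comp]
  congr 1
  rw [Finset.sum_product]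
  simp only [Finset.sum_comm (s := F) (t := univ)]

lemma NN_sq_le {d : ℕ} (k : Fin d → ℤ) : NN k ^ 2 ≤ (d + 1) * (1 + ∑ i, (k i : ℝ) ^ 2) := by
  have h := sq_sum_le_card_mul_sum_sq (s := (univ : Finset (Option (Fin d))))
    (f := fun o => o.elim (1:ℝ) fun i => |(k i : ℝ)|)
  simpa [Fintype.sum_option, NN] using h

/-- The weighted energy estimate. -/
lemma energy {d m : ℕ} {c : ℝ} (hc : 0 < c) {A : Fin d → Fin d → (Fin d → ℤ) → ℂ} (hE : EllF c A)
    (hA : ∀ i j, RD (A i j)) {B : Fin d → (Fin d → ℤ) → ℂ} (hB : ∀ j, RD (B j))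
    {Q : Fin m → (Fin d → ℤ) → ℂ} (hQ : ∀ γ, RD (Q γ)) (u : Fin m → (Fin d → ℤ) → ℂ)
    (hu : ∃ K, ∀ γ k, ‖u γ k‖ ≤ K) (α : Fin m)
    (heq : ∀ k, ∑ i, ∑ j, (k i : ℂ) * (k j : ℂ) * cv (A i j) (u α) k
      + ∑ j, (k j : ℂ) * cv (B j) (u α) k + ∑ γ, cv (Q γ) (u γ) k = 0)
    {C : ℝ} {p : ℕ} {w : (Fin d → ℤ) → ℝ} (hw : ModW C p w)
    (hZ : Summable fun k => (NN k * (w k * ‖u α k‖)) ^ 2)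
    (hV : Summable fun k => (∑ γ, w k * ‖u γ k‖) ^ 2) {δ : ℝ} (hδ : 0 < δ) :
    c * ((d + 1 : ℝ)⁻¹ * ∑' k, (NN k * (w k * ‖u α k‖)) ^ 2 - ∑' k, (∑ γ, w k * ‖u γ k‖) ^ 2)
      ≤ (∑' k, (2 * C + 1) * (NN k ^ (p + 1) *
          (∑ i, ∑ j, ‖A i j k‖ + ∑ j, ‖B j k‖ + ∑ γ, ‖Q γ k‖)))
        * (δ * ∑' k, (NN k * (w k * ‖u α k‖)) ^ 2 + δ⁻¹ * ∑' k, (∑ γ, w k * ‖u γ k‖) ^ 2) := by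
  obtain ⟨K, hu⟩ := hu
  have c0 := hw.C0
  have hw0 := hw.pos
  set D : (Fin d → ℤ) → ℝ := fun k => (2 * C + 1) * (NN k ^ (p + 1) *
          (∑ i, ∑ j, ‖A i j k‖ + ∑ j, ‖B j k‖ + ∑ γ, ‖Q γ k‖)) with hD
  set Z : (Fin d → ℤ) → ℝ := fun k => NN k * (w k * ‖u α k‖) with hZd
  set V : (Fin d → ℤ) → ℝ := fun k => ∑ γ, w k * ‖u γ k‖ with hVd
  have hD0 : ∀ k, 0 ≤ D k := fun k => by
    have := NN_pos k
    simp only [hD]; positivity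
  have hDs : Summable D := by
    refine Summable.mul_left _ ?_
    have h1 : Summable fun k => ∑ i, ∑ j, ‖A i j k‖ * NN k ^ (p + 1) :=
      summable_sum fun i _ => summable_sum fun j _ => (hA i j).summable (p + 1)
    have h2 : Summable fun k => ∑ j, ‖B j k‖ * NN k ^ (p + 1) :=
      summable_sum fun j _ => (hB j).summable (p + 1)
    have h3 : Summable fun k => ∑ γ, ‖Q γ k‖ * NN k ^ (p + 1) :=
      summable_sum fun j _ => (hQ j).summable (p + 1)
    refine ((h1.add h2).add h3).congr fun k => ?_
    simp only [← Finset.sum_mul]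
    ring
  have hZ0 : ∀ k, 0 ≤ Z k := fun k => by
    have := NN_pos k; have := hw0 k
    simp only [hZd]; positivity
  have hV0 : ∀ k, 0 ≤ V k := fun k => Finset.sum_nonneg fun γ _ =>
    mul_nonneg (hw0 k).le (norm_nonneg _)
  have hVα : ∀ γ k, w k * ‖u γ k‖ ≤ V k := fun γ k =>
    Finset.single_le_sum (f := fun γ => w k * ‖u γ k‖)
      (fun γ _ => mul_nonneg (hw0 k).le (norm_nonneg _)) (Finset.mem_univ γ)
  obtain ⟨yS, yB⟩ := young hD0 hDs hZ hV hZ0 hV0 hδ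
  set v : (Fin d → ℤ) → ℂ := fun k => w k * u α k with hv
  have hvn : ∀ k, ‖v k‖ = w k * ‖u α k‖ := fun k => by
    simp [hv, abs_of_pos (hw0 k)]
  set z : Fin d → (Fin d → ℤ) → ℂ := fun i k => k i * v k with hzd
  have hzn : ∀ i k, ‖z i k‖ = |(k i : ℝ)| * (w k * ‖u α k‖) := fun i k => by
    simp only [hzd, norm_mul, hvn, Complex.norm_intCast]
  have hkN : ∀ (k : Fin d → ℤ) i, |(k i : ℝ)| ≤ NN k := fun k i => by linarith [abs_le_NN k i]
  have hzZ : ∀ i k, ‖z i k‖ ≤ Z k := fun i k => by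
    rw [hzn]
    exact mul_le_mul_of_nonneg_right (hkN k i) (mul_nonneg (hw0 k).le (norm_nonneg _))
  have hvZ : ∀ k, ‖v k‖ ≤ Z k := fun k => by
    rw [hvn]
    exact le_mul_of_one_le_left (mul_nonneg (hw0 k).le (norm_nonneg _)) (NN_ge_one k)
  have hz : ∀ i, Summable fun k => ‖z i k‖ ^ 2 := fun i =>
    Summable.of_nonneg_of_le (fun k => sq_nonneg _)
      (fun k => pow_le_pow_left₀ (norm_nonneg _) (hzZ i k) 2) hZ
  obtain ⟨pS, pE⟩ := ell_inf hE hA hz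
  set P : (Fin d → ℤ) × (Fin d → ℤ) → ℂ := fun q =>
      ∑ i, ∑ j, (starRingEnd ℂ) (z i q.1) * A i j (q.1 - q.2) * z j q.2 with hP
  set T : (Fin d → ℤ) × (Fin d → ℤ) → ℂ := fun q => (w q.1 * (starRingEnd ℂ) (v q.1)) *
      (∑ i, ∑ j, (q.1 i : ℂ) * (q.1 j : ℂ) * (A i j (q.1 - q.2) * u α q.2)
        + ∑ j, (q.1 j : ℂ) * (B j (q.1 - q.2) * u α q.2) + ∑ γ, Q γ (q.1 - q.2) * u γ q.2) with hT
  have hR : ∀ q, ‖T q - P q‖ ≤ D (q.1 - q.2) * (Z q.1 * V q.2) := by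
    rintro ⟨k, l⟩
    simp only
    have hN := NN_ge_one (k - l)
    have hNp : 0 < NN (k - l) := NN_pos _
    set G : ℝ := (2 * C + 1) * NN (k - l) ^ (p + 1) with hG
    have hG0 : 0 ≤ G := by positivity
    have hwG : w k ≤ G * w l := by
      refine (hw.le1 k l).trans (mul_le_mul_of_nonneg_right ?_ (hw0 l).le)
      have : NN (k - l) ^ p ≤ NN (k - l) ^ (p + 1) := pow_le_pow_right₀ hN (Nat.le_succ p)
      exact mul_le_mul (by linarith) this (by positivity) (by positivity)
    have e : T (k, l) - P (k, l)
        = ∑ i, ∑ j, (((k i : ℂ) * (starRingEnd ℂ) (v k)) * A i j (k - l)) *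
            ((((k j : ℝ) * w k - l j * w l : ℝ) : ℂ) * u α l)
          + ∑ j, (((k j : ℂ) * (starRingEnd ℂ) (v k)) * B j (k - l)) * ((w k : ℂ) * u α l)
          + ∑ γ, (((starRingEnd ℂ) (v k)) * Q γ (k - l)) * ((w k : ℂ) * u γ l) := by
      simp only [hT, hP, mul_add, Finset.mul_sum]
      have e1 : ∀ i j, w k * (starRingEnd ℂ) (v k) *
          ((k i : ℂ) * (k j : ℂ) * (A i j (k - l) * u α l))
          = (((k i : ℂ) * (starRingEnd ℂ) (v k)) * A i j (k - l)) *
            ((((k j : ℝ) * w k - l j * w l : ℝ) : ℂ) * u α l)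
            + (starRingEnd ℂ) (z i k) * A i j (k - l) * z j l := by
        intro i j
        simp only [hzd, map_mul, map_intCast]
        simp only [hv]
        push_cast
        ring
      simp only [e1, Finset.sum_add_distrib]
      have e2 : ∀ j, w k * (starRingEnd ℂ) (v k) * ((k j : ℂ) * (B j (k - l) * u α l))
          = (((k j : ℂ) * (starRingEnd ℂ) (v k)) * B j (k - l)) * ((w k : ℂ) * u α l) := by
        intro j; ring
      have e3 : ∀ γ, w k * (starRingEnd ℂ) (v k) * (Q γ (k - l) * u γ l)
          = (((starRingEnd ℂ) (v k)) * Q γ (k - l)) * ((w k : ℂ) * u γ l) := by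
        intro j; ring
      simp only [e2, e3]
      ring
    have hb : ∀ (x y t : ℂ) (W : ℝ) (γ : Fin m), ‖x‖ ≤ Z k → ‖t‖ ≤ G * w l →
        ‖x * y * (t * u γ l)‖ ≤ ‖y‖ * (G * (Z k * V l)) := by
      intro x y t W γ hx ht
      rw [norm_mul, norm_mul, norm_mul]
      have h1 : ‖t‖ * ‖u γ l‖ ≤ G * V l := by
        calc ‖t‖ * ‖u γ l‖ ≤ (G * w l) * ‖u γ l‖ := by gcongr
          _ = G * (w l * ‖u γ l‖) := by ring
          _ ≤ _ := mul_le_mul_of_nonneg_left (hVα γ l) hG0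
      calc ‖x‖ * ‖y‖ * (‖t‖ * ‖u γ l‖) ≤ (Z k * ‖y‖) * (G * V l) := by
            have := hZ0 k
            exact mul_le_mul (mul_le_mul_of_nonneg_right hx (norm_nonneg _)) h1 (by positivity)
              (by positivity)
        _ = _ := by ring
    have hzc : ∀ i, ‖(k i : ℂ) * (starRingEnd ℂ) (v k)‖ ≤ Z k := fun i => by
      have := hzZ i k
      simpa [hzd] using this
    have hvc : ‖(starRingEnd ℂ) (v k)‖ ≤ Z k := by simpa using hvZ k
    have hwn : ‖(w k : ℂ)‖ ≤ G * w l := by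
      rw [Complex.norm_real, Real.norm_eq_abs, abs_of_pos (hw0 k)]; exact hwG
    have hcn : ∀ j, ‖(((k j : ℝ) * w k - l j * w l : ℝ) : ℂ)‖ ≤ G * w l := fun j => by
      rw [Complex.norm_real, Real.norm_eq_abs]; exact hw.coord k l j
    rw [e]
    have b1 := norm_sum_le_of_le (s := univ) (fun i (_ : i ∈ univ) =>
      norm_sum_le_of_le (s := univ) (fun j (_ : j ∈ univ) => hb _ (A i j (k - l)) _ 0 α (hzc i) (hcn j)))
    have b2 := norm_sum_le_of_le (s := univ) (fun j (_ : j ∈ univ) =>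
      hb _ (B j (k - l)) _ 0 α (hzc j) hwn)
    have b3 := norm_sum_le_of_le (s := univ) (fun γ (_ : γ ∈ univ) =>
      hb _ (Q γ (k - l)) _ 0 γ hvc hwn)
    refine (norm_add₃_le).trans ((add_le_add (add_le_add b1 b2) b3).trans (le_of_eq ?_))
    simp only [← Finset.sum_mul, hD, hG]
    ring
  have hRs : Summable (fun q => T q - P q) := Summable.of_norm_bounded yS hR
  have hTs : Summable T := by
    have := hRs.add pS
    simpa using this
  have hT0 : ∑' q, T q = 0 := by
    rw [hTs.tsum_prod]
    have : ∀ k, ∑' l, T (k, l) = 0 := by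
      intro k
      have s1 : ∀ i j, HasSum (fun l => (k i : ℂ) * (k j : ℂ) * (A i j (k - l) * u α l))
          ((k i : ℂ) * (k j : ℂ) * cv (A i j) (u α) k) := fun i j =>
        ((hA i j).cv_summable (hu α) k).of_norm.hasSum.mul_left _
      have s2 : ∀ j, HasSum (fun l => (k j : ℂ) * (B j (k - l) * u α l))
          ((k j : ℂ) * cv (B j) (u α) k) := fun j =>
        ((hB j).cv_summable (hu α) k).of_norm.hasSum.mul_left _
      have s3 : ∀ γ, HasSum (fun l => Q γ (k - l) * u γ l) (cv (Q γ) (u γ) k) := fun γ =>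
        ((hQ γ).cv_summable (hu γ) k).of_norm.hasSum
      have := (((hasSum_sum (s := univ) fun i _ => hasSum_sum (s := univ) fun j _ => s1 i j).add
        (hasSum_sum (s := univ) fun j _ => s2 j)).add
        (hasSum_sum (s := univ) fun γ _ => s3 γ)).mul_left (w k * (starRingEnd ℂ) (v k))
      rw [heq k, mul_zero] at this
      exact this.tsum_eq
    simp [this]
  have hPR : ∑' q, P q = -∑' q, (T q - P q) := by
    rw [hTs.tsum_sub pS, hT0]; ring
  have h1 : (∑' q, P q).re ≤ (∑' k, D k) * (δ * ∑' k, Z k ^ 2 + δ⁻¹ * ∑' k, V k ^ 2) := by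
    refine le_trans ?_ yB
    refine (Complex.re_le_norm _).trans ?_
    rw [hPR, norm_neg]
    exact (tsum_of_norm_bounded yS.hasSum hR)
  refine le_trans ?_ h1
  refine le_trans ?_ pE
  refine mul_le_mul_of_nonneg_left ?_ hc.le
  have hZle : ∀ k, Z k ^ 2 ≤ (d + 1) * (V k ^ 2 + ∑ i, ‖z i k‖ ^ 2) := by
    intro k
    have h2 := NN_sq_le k
    have h3 : (w k * ‖u α k‖) ^ 2 ≤ V k ^ 2 :=
      pow_le_pow_left₀ (mul_nonneg (hw0 k).le (norm_nonneg _)) (hVα α k) 2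
    have h4 : ∑ i, ‖z i k‖ ^ 2 = (∑ i, (k i : ℝ) ^ 2) * (w k * ‖u α k‖) ^ 2 := by
      rw [Finset.sum_mul]
      refine Finset.sum_congr rfl fun i _ => ?_
      rw [hzn, mul_pow, sq_abs]
    calc Z k ^ 2 = NN k ^ 2 * (w k * ‖u α k‖) ^ 2 := by simp only [hZd]; ring
      _ ≤ ((d + 1) * (1 + ∑ i, (k i : ℝ) ^ 2)) * (w k * ‖u α k‖) ^ 2 :=
        mul_le_mul_of_nonneg_right h2 (sq_nonneg _)
      _ = (d + 1) * ((w k * ‖u α k‖) ^ 2 + (∑ i, (k i : ℝ) ^ 2) * (w k * ‖u α k‖) ^ 2) := by ring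
      _ ≤ _ := by rw [h4]; gcongr
  have hsum := summable_sum (s := univ) fun i (_ : i ∈ univ) => hz i
  have h5 := hZ.tsum_le_tsum hZle ((hV.add hsum).mul_left _)
  rw [tsum_mul_left, hV.tsum_add hsum, Summable.tsum_finsetSum fun i _ => hz i] at h5
  have hd : (0:ℝ) < d + 1 := by positivity
  rw [sub_le_iff_le_add, inv_mul_le_iff₀ hd]
  linarith


lemma wt_le {d : ℕ} (s : ℤ) {ε : ℝ} (hε : 0 < ε) (k : Fin d → ℤ) : wt s ε k ≤ NN k ^ s := by
  have h := NN_pos k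
  unfold wt
  refine mul_le_of_le_one_right (by positivity) (inv_le_one_of_one_le₀ ?_)
  have := mul_pos hε h
  linarith

lemma NN_wt_le {d : ℕ} (s : ℤ) {ε : ℝ} (hε : 0 < ε) (k : Fin d → ℤ) :
    NN k * wt s ε k ≤ ε⁻¹ * NN k ^ s := by
  have h := NN_pos k
  unfold wt
  have h1 : NN k * (1 + ε * NN k)⁻¹ ≤ ε⁻¹ := by
    rw [← div_eq_mul_inv, div_le_iff₀ (by positivity), inv_mul_eq_div, le_div_iff₀ hε]
    linarith
  calc NN k * (NN k ^ s * (1 + ε * NN k)⁻¹) = (NN k * (1 + ε * NN k)⁻¹) * NN k ^ s := by ring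
    _ ≤ _ := by gcongr

lemma reg_step {d m : ℕ} {c : ℝ} (hc : 0 < c) {A : Fin d → Fin d → (Fin d → ℤ) → ℂ} (hE : EllF c A)
    (hA : ∀ i j, RD (A i j)) {B : Fin d → (Fin d → ℤ) → ℂ} (hB : ∀ j, RD (B j))
    {Q : Fin m → (Fin d → ℤ) → ℂ} (hQ : ∀ γ, RD (Q γ)) (u : Fin m → (Fin d → ℤ) → ℂ)
    (hu : ∃ K, ∀ γ k, ‖u γ k‖ ≤ K) (α : Fin m)
    (heq : ∀ k, ∑ i, ∑ j, (k i : ℂ) * (k j : ℂ) * cv (A i j) (u α) k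
      + ∑ j, (k j : ℂ) * cv (B j) (u α) k + ∑ γ, cv (Q γ) (u γ) k = 0) (s : ℤ)
    (hs : ∀ γ, Summable fun k => (NN k ^ s * ‖u γ k‖) ^ 2) :
    Summable fun k => (NN k ^ (s + 1) * ‖u α k‖) ^ 2 := by
  obtain ⟨C, p, hw⟩ := mod_wt (d := d) s
  have hW : Summable fun k => (∑ γ, NN k ^ s * ‖u γ k‖) ^ 2 := by
    refine Summable.of_nonneg_of_le (fun k => sq_nonneg _) (fun k => sq_sum_le_card_mul_sum_sq) ?_
    exact (summable_sum fun γ _ => hs γ).mul_left _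
  set E := ∑' k, (∑ γ, NN k ^ s * ‖u γ k‖) ^ 2 with hEd
  set S := ∑' k, (2 * C + 1) * (NN k ^ (p + 1) *
          (∑ i, ∑ j, ‖A i j k‖ + ∑ j, ‖B j k‖ + ∑ γ, ‖Q γ k‖)) with hS
  have c0 : 0 ≤ C := (hw 1 one_pos).C0
  have hS0 : 0 ≤ S := tsum_nonneg fun k => by have := NN_pos k; positivity
  have hd : (0:ℝ) < d + 1 := by positivity
  set δ := c / (2 * (d + 1) * (S + 1)) with hδd
  have hδ : 0 < δ := by positivity
  have hSδ : S * δ ≤ c / (2 * (d + 1)) := by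
    rw [hδd, ← mul_div_assoc, div_le_div_iff₀ (by positivity) (by positivity)]
    have : 0 ≤ c * (2 * (d + 1)) := by positivity
    nlinarith
  have hbd : ∀ ε : ℝ, 0 < ε → ∀ F : Finset (Fin d → ℤ),
      ∑ k ∈ F, (NN k * (wt s ε k * ‖u α k‖)) ^ 2 ≤ (2 * (d + 1) / c) * ((c + S * δ⁻¹) * E) := by
    intro ε hε F
    have wp := (hw ε hε).pos
    have hZ : Summable fun k => (NN k * (wt s ε k * ‖u α k‖)) ^ 2 := by
      refine Summable.of_nonneg_of_le (fun k => sq_nonneg _) (fun k => ?_) ((hs α).mul_left (ε⁻¹ ^ 2))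
      rw [← mul_pow]
      have := NN_pos k
      have := wp k
      refine pow_le_pow_left₀ (by positivity) ?_ 2
      have := mul_le_mul_of_nonneg_right (NN_wt_le s hε k) (norm_nonneg (u α k))
      linarith
    have hVle : ∀ k, (∑ γ, wt s ε k * ‖u γ k‖) ^ 2 ≤ (∑ γ, NN k ^ s * ‖u γ k‖) ^ 2 := fun k =>
      pow_le_pow_left₀ (Finset.sum_nonneg fun γ _ => mul_nonneg (wp k).le (norm_nonneg _))
        (Finset.sum_le_sum fun γ _ => mul_le_mul_of_nonneg_right (wt_le s hε k) (norm_nonneg _)) 2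
    have hV : Summable fun k => (∑ γ, wt s ε k * ‖u γ k‖) ^ 2 :=
      Summable.of_nonneg_of_le (fun k => sq_nonneg _) hVle hW
    have key := energy hc hE hA hB hQ u hu α heq (hw ε hε) hZ hV hδ
    have hVE : ∑' k, (∑ γ, wt s ε k * ‖u γ k‖) ^ 2 ≤ E := hV.tsum_le_tsum hVle hW
    refine (hZ.sum_le_tsum F fun k _ => sq_nonneg _).trans ?_
    rw [← hS] at key
    set X := ∑' k, (NN k * (wt s ε k * ‖u α k‖)) ^ 2
    set Y := ∑' k, (∑ γ, wt s ε k * ‖u γ k‖) ^ 2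
    have hX0 : 0 ≤ X := tsum_nonneg fun k => sq_nonneg _
    have h1 : S * δ * X ≤ c / (2 * (d + 1)) * X := mul_le_mul_of_nonneg_right hSδ hX0
    have h2 : (c + S * δ⁻¹) * Y ≤ (c + S * δ⁻¹) * E := mul_le_mul_of_nonneg_left hVE (by positivity)
    have h3 : c * ((d + 1 : ℝ)⁻¹ * X) = 2 * (c / (2 * (d + 1)) * X) := by field_simp
    have h4 : c / (2 * (d + 1)) * X ≤ (c + S * δ⁻¹) * E := by nlinarith
    calc X = (2 * (d + 1) / c) * (c / (2 * (d + 1)) * X) := by field_simp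
      _ ≤ _ := mul_le_mul_of_nonneg_left h4 (by positivity)
  refine summable_of_sum_le (fun k => sq_nonneg _) (c := (2 * (d + 1) / c) * ((c + S * δ⁻¹) * E))
    fun F => ?_
  have ht : Filter.Tendsto (fun ε : ℝ => ∑ k ∈ F, (NN k * (wt s ε k * ‖u α k‖)) ^ 2)
      (nhdsWithin 0 (Set.Ioi 0)) (nhds (∑ k ∈ F, (NN k * (wt s 0 k * ‖u α k‖)) ^ 2)) := by
    refine Filter.Tendsto.mono_left ?_ nhdsWithin_le_nhds
    refine tendsto_finsetSum _ fun k _ => ?_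
    have : ContinuousAt (fun ε : ℝ => (NN k * (wt s ε k * ‖u α k‖)) ^ 2) 0 := by
      have h1 : ContinuousAt (fun ε : ℝ => (1 + ε * NN k)⁻¹) 0 :=
        ContinuousAt.inv₀ (by fun_prop) (by simp)
      unfold wt
      fun_prop
    exact this
  have := le_of_tendsto ht (Filter.eventually_of_mem self_mem_nhdsWithin fun ε hε => hbd ε hε F)
  refine le_trans (le_of_eq ?_) this
  refine Finset.sum_congr rfl fun k _ => ?_
  rw [wt, zpow_add_one₀ (NN_pos k).ne']
  simp
  ring

lemma regularity {d m : ℕ} {c : ℝ} (hc : 0 < c) {A : Fin m → Fin d → Fin d → (Fin d → ℤ) → ℂ}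
    (hE : ∀ α, EllF c (A α))
    (hA : ∀ α i j, RD (A α i j)) {B : Fin m → Fin d → (Fin d → ℤ) → ℂ} (hB : ∀ α j, RD (B α j))
    {Q : Fin m → Fin m → (Fin d → ℤ) → ℂ} (hQ : ∀ α γ, RD (Q α γ)) (u : Fin m → (Fin d → ℤ) → ℂ)
    (hu : ∃ K, ∀ γ k, ‖u γ k‖ ≤ K)
    (heq : ∀ α k, ∑ i, ∑ j, (k i : ℂ) * (k j : ℂ) * cv (A α i j) (u α) k
      + ∑ j, (k j : ℂ) * cv (B α j) (u α) k + ∑ γ, cv (Q α γ) (u γ) k = 0) (α : Fin m) :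
    RD (u α) := by
  have h : ∀ n : ℕ, ∀ γ, Summable fun k => (NN k ^ (-(d:ℤ) + n) * ‖u γ k‖) ^ 2 := by
    intro n
    induction n with
    | zero =>
      intro γ
      obtain ⟨K, hK⟩ := hu
      refine Summable.of_nonneg_of_le (fun k => sq_nonneg _) (fun k => ?_)
        ((summable_NN d).mul_left (K ^ 2))
      have hp := NN_pos k
      have e : (NN k ^ (-(d:ℤ) + (0:ℕ)) * ‖u γ k‖) ^ 2 = ‖u γ k‖ ^ 2 * (NN k ^ (2 * d))⁻¹ := by
        simp only [Nat.cast_zero, add_zero, _root_.zpow_neg, zpow_natCast]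
        rw [mul_pow, inv_pow, ← pow_mul, mul_comm d 2]
        ring
      rw [e]
      gcongr
      exact hK γ k
    | succ n ih =>
      intro γ
      have := reg_step hc (hE γ) (hA γ) (hB γ) (hQ γ) u hu γ (heq γ) _ ih
      rw [add_assoc] at this
      exact_mod_cast this
  intro p
  have h1 := h (d + p) α
  have e : (-(d:ℤ) + ((d + p : ℕ) : ℤ)) = p := by push_cast; ring
  simp only [e, zpow_natCast] at h1
  refine ⟨1 + ∑' k, (NN k ^ p * ‖u α k‖) ^ 2, fun n => ?_⟩
  have h2 := h1.le_tsum n fun j _ => sq_nonneg _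
  nlinarith [sq_nonneg (NN n ^ p * ‖u α n‖ - 1)]


/-! ### Fourier coefficients of the invariant functional -/

def sgl {d m : ℕ} (α : Fin m) (g : (Fin d → ℝ) → ℝ) : (Fin d → ℝ) → Fin m → ℝ :=
  fun x γ => if γ = α then g x else 0

lemma sgl_add {d m : ℕ} (α : Fin m) (f g : (Fin d → ℝ) → ℝ) :
    sgl α (fun x => f x + g x) = sgl α f + sgl α g := by
  funext x γ
  by_cases h : γ = α <;> simp [sgl, h]

lemma sgl_smul {d m : ℕ} (α : Fin m) (t : ℝ) (g : (Fin d → ℝ) → ℝ) :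
    sgl α (fun x => t * g x) = t • sgl α g := by
  funext x γ
  by_cases h : γ = α <;> simp [sgl, h]

abbrev Fun (d m : ℕ) : Type := (Fin d → ℝ) → Fin m → ℝ

def nu {d m : ℕ} (μ : Fun d m →ₗ[ℝ] ℝ) (α : Fin m) : ((Fin d → ℝ) → ℂ) →ₗ[ℂ] ℂ where
  toFun g := ⟨μ (sgl α fun x => (g x).re), μ (sgl α fun x => (g x).im)⟩
  map_add' f g := by
    apply Complex.ext
    · simp only [Pi.add_apply, Complex.add_re, sgl_add, map_add]
    · simp only [Pi.add_apply, Complex.add_im, sgl_add, map_add]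
  map_smul' t g := by
    have e1 : (fun x => (t • g) x |>.re) = fun x => t.re * (g x).re + (-t.im) * (g x).im := by
      funext x; simp; ring
    have e2 : (fun x => (t • g) x |>.im) = fun x => t.re * (g x).im + t.im * (g x).re := by
      funext x; simp
    apply Complex.ext
    · simp only [e1, sgl_add, sgl_smul, map_add, map_smul]
      simp
      ring
    · simp only [e2, sgl_add, sgl_smul, map_add, map_smul]
      simp

lemma nu_re {d m : ℕ} (μ : Fun d m →ₗ[ℝ] ℝ) (α : Fin m) (g : (Fin d → ℝ) → ℂ) :
    (nu μ α g).re = μ (sgl α fun x => (g x).re) := rfl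

lemma nu_im {d m : ℕ} (μ : Fun d m →ₗ[ℝ] ℝ) (α : Fin m) (g : (Fin d → ℝ) → ℂ) :
    (nu μ α g).im = μ (sgl α fun x => (g x).im) := rfl

/-- The order bound enjoyed by the functional. -/
def Sub1 {d m : ℕ} (μ : Fun d m →ₗ[ℝ] ℝ) : Prop :=
  ∀ (f : (Fin d → ℝ) → Fin m → ℝ) C, (∃ D, ∀ x α, |f x α| ≤ D) → (∀ x α, f x α ≤ C) → μ f ≤ C

lemma Sub1.le {d m : ℕ} {μ : Fun d m →ₗ[ℝ] ℝ} (h : Sub1 μ) (α : Fin m) {g : (Fin d → ℝ) → ℝ} {C D : ℝ}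
    (hC : 0 ≤ C) (hg : ∀ x, |g x| ≤ D) (hgC : ∀ x, g x ≤ C) : μ (sgl α g) ≤ C := by
  have hD : 0 ≤ D := (abs_nonneg _).trans (hg 0)
  refine h _ C ⟨D, fun x γ => ?_⟩ fun x γ => ?_
  · by_cases e : γ = α <;> simp [sgl, e, hg, hD]
  · by_cases e : γ = α <;> simp [sgl, e, hgC, hC]

lemma Sub1.nonneg {d m : ℕ} {μ : Fun d m →ₗ[ℝ] ℝ} (h : Sub1 μ) (α : Fin m) {g : (Fin d → ℝ) → ℝ}
    {D : ℝ} (hg : ∀ x, |g x| ≤ D) (hg0 : ∀ x, 0 ≤ g x) : 0 ≤ μ (sgl α g) := by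
  have := h.le α (g := fun x => (-1) * g x) (C := 0) (D := D) le_rfl (fun x => by simpa using hg x)
    (fun x => by linarith [hg0 x])
  rw [sgl_smul, map_smul, smul_eq_mul] at this
  linarith

lemma Sub1.abs_le {d m : ℕ} {μ : Fun d m →ₗ[ℝ] ℝ} (h : Sub1 μ) (α : Fin m) {g : (Fin d → ℝ) → ℝ}
    {C : ℝ} (hg : ∀ x, |g x| ≤ C) : |μ (sgl α g)| ≤ C := by
  have hC : 0 ≤ C := (abs_nonneg _).trans (hg 0)
  have h1 := h.le α (g := fun x => (-1) * g x) (C := C) (D := C) hC (fun x => by simpa using hg x)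
    (fun x => by linarith [neg_abs_le (g x), hg x])
  have h2 := h.le α hC hg fun x => (le_abs_self _).trans (hg x)
  rw [sgl_smul, map_smul, smul_eq_mul] at h1
  rw [_root_.abs_le]
  constructor <;> linarith

lemma Sub1.nu_le {d m : ℕ} {μ : Fun d m →ₗ[ℝ] ℝ} (h : Sub1 μ) (α : Fin m) {g : (Fin d → ℝ) → ℂ}
    {C : ℝ} (hg : ∀ x, ‖g x‖ ≤ C) : ‖nu μ α g‖ ≤ 2 * C := by
  have h1 := h.abs_le α (g := fun x => (g x).re) fun x => (Complex.abs_re_le_norm _).trans (hg x)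
  have h2 := h.abs_le α (g := fun x => (g x).im) fun x => (Complex.abs_im_le_norm _).trans (hg x)
  refine (Complex.norm_le_abs_re_add_abs_im _).trans ?_
  rw [nu_re, nu_im]
  linarith

lemma Sub1.one {d m : ℕ} {μ : Fun d m →ₗ[ℝ] ℝ} (h : Sub1 μ) : ∑ α, μ (sgl α fun _ => 1) = 1 := by
  rw [← map_sum]
  have e : (∑ α, sgl (d := d) (m := m) α fun _ => 1) = fun _ _ => 1 := by
    funext x γ
    simp [sgl, Finset.sum_apply]
  rw [e]
  apply le_antisymm
  · exact h _ 1 ⟨1, fun x α => by simp⟩ fun x α => le_rfl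
  · have h1 := h (-fun _ _ => 1) (-1) ⟨1, fun x α => by simp⟩ fun x α => by simp
    rw [map_neg] at h1
    linarith

def uh {d m : ℕ} (μ : Fun d m →ₗ[ℝ] ℝ) (α : Fin m) (k : Fin d → ℤ) : ℂ := nu μ α (ee (-k))

lemma Sub1.uh_le {d m : ℕ} {μ : Fun d m →ₗ[ℝ] ℝ} (h : Sub1 μ) : ∃ K, ∀ γ k, ‖uh μ γ k‖ ≤ K :=
  ⟨2 * 1, fun γ _ => h.nu_le γ fun _ => (norm_ee _ _).le⟩

lemma Sub1.nu_FS {d m : ℕ} {μ : Fun d m →ₗ[ℝ] ℝ} (h : Sub1 μ) (α : Fin m) {c : (Fin d → ℤ) → ℂ}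
    (hc : RD c) (k : Fin d → ℤ) :
    nu μ α (fun x => FS c x * ee (-k) x) = cv c (uh μ α) k := by
  have hn : Summable fun l => ‖c (k - l)‖ := (Equiv.subLeft k).summable_iff.2 hc.summable_norm
  have hx : ∀ x, HasSum (fun l => c (k - l) * ee (-l) x) (FS c x * ee (-k) x) := by
    intro x
    have h1 := ((hc.fs_summable x).of_norm.hasSum.mul_right (ee (-k) x))
    have h2 := (Equiv.subLeft k).hasSum_iff.2 h1
    have e : (fun l => c (k - l) * ee (-l) x)
        = (fun n => c n * ee n x * ee (-k) x) ∘ (Equiv.subLeft k) := by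
      funext l
      simp only [Function.comp, Equiv.subLeft_apply]
      rw [mul_assoc, ← ee_add]
      congr 2
      abel
    rw [e]
    exact h2
  have hs : HasSum (fun l => c (k - l) * uh μ α l) (nu μ α (fun x => FS c x * ee (-k) x)) := by
    rw [HasSum, SummationFilter.unconditional_filter, tendsto_iff_norm_sub_tendsto_zero]
    have ht := (tendsto_tsum_compl_atTop_zero fun l => ‖c (k - l)‖).const_mul 2
    rw [mul_zero] at ht
    refine squeeze_zero (fun F => norm_nonneg _) (fun F => ?_) ht
    have e : ∑ l ∈ F, c (k - l) * uh μ α l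
        = nu μ α (fun x => ∑ l ∈ F, c (k - l) * ee (-l) x) := by
      have : (fun x => ∑ l ∈ F, c (k - l) * ee (-l) x) = ∑ l ∈ F, c (k - l) • ee (-l) := by
        funext x
        simp [Finset.sum_apply]
      rw [this, map_sum]
      simp only [map_smul, smul_eq_mul, uh]
    rw [e, ← map_sub]
    refine h.nu_le α fun x => ?_
    simp only [Pi.sub_apply]
    rw [← (hx x).tsum_eq, ← (hx x).summable.sum_add_tsum_subtype_compl F, sub_add_cancel_left, norm_neg]
    refine tsum_of_norm_bounded (hn.subtype _).hasSum fun l => ?_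
    simp [norm_ee]
  exact hs.tsum_eq.symm

lemma Sub1.nu_mul {d m : ℕ} {μ : Fun d m →ₗ[ℝ] ℝ} (h : Sub1 μ) (α : Fin m) {g : (Fin d → ℝ) → ℝ}
    (hg : ContDiff ℝ (⊤ : ℕ∞) g) (hp : Per g) (k : Fin d → ℤ) :
    nu μ α (fun x => (g x : ℂ) * ee (-k) x) = cv (fc g) (uh μ α) k := by
  rw [← h.nu_FS α (RD_fc hg hp) k]
  simp only [FS_fc hg hp]

lemma hasFDerivAt_re {d : ℕ} {f : (Fin d → ℝ) → ℂ} {x : Fin d → ℝ} (hf : DifferentiableAt ℝ f x)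
    (j : Fin d) : pd (fun y => (f y).re) j x = (fderiv ℝ f x (Pi.single j 1)).re := by
  have := (Complex.reCLM.hasFDerivAt.comp x hf.hasFDerivAt).fderiv
  unfold pd
  have e : (fun y => (f y).re) = Complex.reCLM ∘ f := rfl
  rw [e, this]
  rfl

lemma pd_re_ee {d : ℕ} (c : ℂ) (n : Fin d → ℤ) (j : Fin d) (x : Fin d → ℝ) :
    pd (fun y => (c * ee n y).re) j x = ((c * (2 * Real.pi * Complex.I * n j)) * ee n x).re := by
  have h : HasFDerivAt (fun y => c * ee n y) (c • (ee n x • eeD n)) x :=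
    (hasFDerivAt_ee n x).const_mul c
  rw [hasFDerivAt_re h.differentiableAt, h.fderiv]
  simp only [_root_.smul_apply, eeD_single, smul_eq_mul]
  congr 1
  ring

lemma pd2_re_ee {d : ℕ} (c : ℂ) (n : Fin d → ℤ) (j k : Fin d) (x : Fin d → ℝ) :
    pd2 (fun y => (c * ee n y).re) j k x
      = (((c * (2 * Real.pi * Complex.I * n j)) * (2 * Real.pi * Complex.I * n k)) * ee n x).re := by
  unfold pd2
  simp only [pd_re_ee]

lemma pd_re_FS {d : ℕ} {c : (Fin d → ℤ) → ℂ} (hc : RD c) (j : Fin d) (x : Fin d → ℝ) :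
    pd (fun y => (FS c y).re) j x = (FS (fun n => 2 * Real.pi * Complex.I * ((n j : ℂ) * c n)) x).re := by
  rw [hasFDerivAt_re (hc.hasFDerivAt x).differentiableAt, hc.deriv]

lemma cv_const_mul {d : ℕ} (t : ℂ) (c c' : (Fin d → ℤ) → ℂ) (k : Fin d → ℤ) :
    cv (fun n => t * c n) c' k = t * cv c c' k := by
  unfold cv
  rw [← tsum_mul_left]
  simp only [mul_assoc]


lemma jump_sgl {d m : ℕ} {q : Fin m → Fin m → (Fin d → ℝ) → ℝ}
    (hq_diag : ∀ α x, q α α x = -∑ β ∈ Finset.univ.filter (fun β => β ≠ α), q α β x)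
    (α : Fin m) (g : (Fin d → ℝ) → ℝ) (x : Fin d → ℝ) (γ : Fin m) :
    jumpOp q (sgl α g) x γ = q γ α x * g x := by
  unfold jumpOp
  simp only [mul_sub, Finset.sum_sub_distrib]
  rw [← Finset.sum_mul]
  have h : ∑ β ∈ Finset.univ.filter (fun β => β ≠ γ), q γ β x = - q γ γ x := by
    rw [hq_diag]; simp
  rw [h]
  by_cases e : γ = α
  · subst e
    have : ∑ β ∈ Finset.univ.filter (fun β => β ≠ γ), q γ β x * sgl γ g x β = 0 := by
      refine Finset.sum_eq_zero fun β hβ => ?_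
      have := (Finset.mem_filter.1 hβ).2
      simp [sgl, this]
    rw [this]
    simp [sgl]
  · have : ∑ β ∈ Finset.univ.filter (fun β => β ≠ γ), q γ β x * sgl α g x β = q γ α x * g x := by
      rw [Finset.sum_eq_single α]
      · simp [sgl]
      · intro β _ hβ
        simp [sgl, hβ]
      · intro hn
        simp at hn
        exact absurd hn.symm e
    rw [this]
    simp [sgl, e]

lemma pd_zero' {d : ℕ} (j : Fin d) (x : Fin d → ℝ) : pd (fun _ : Fin d → ℝ => (0:ℝ)) j x = 0 := by
  simp [pd]

lemma gen_sgl {d m : ℕ} (b : (Fin d → ℝ) → Fin m → Fin d → ℝ)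
    (a : (Fin d → ℝ) → Fin m → Matrix (Fin d) (Fin d) ℝ) {q : Fin m → Fin m → (Fin d → ℝ) → ℝ}
    (hq_diag : ∀ α x, q α α x = -∑ β ∈ Finset.univ.filter (fun β => β ≠ α), q α β x)
    (α : Fin m) (g : (Fin d → ℝ) → ℝ) :
    gen b a q (sgl α g) = sgl α (fun x => (∑ j, b x α j * pd g j x)
        + (1/2) * ∑ j, ∑ k, a x α j k * pd2 g j k x) + ∑ γ, sgl γ (fun x => q γ α x * g x) := by
  funext x γ
  unfold gen
  rw [jump_sgl hq_diag]
  simp only [Pi.add_apply, Finset.sum_apply]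
  have e : ∑ γ', sgl γ' (fun x => q γ' α x * g x) x γ = q γ α x * g x := by
    simp [sgl]
  rw [e]
  congr 1
  by_cases h : γ = α
  · subst h
    simp [sgl]
  · simp [sgl, h, pd2, pd_zero']

lemma weak_eq {d r m : ℕ} {b : (Fin d → ℝ) → Fin m → Fin d → ℝ}
    {σ : (Fin d → ℝ) → Fin m → Matrix (Fin d) (Fin r) ℝ} {q : Fin m → Fin m → (Fin d → ℝ) → ℝ}
    (hb : ∀ α j, ContDiff ℝ (⊤ : ℕ∞) fun x => b x α j)
    (ha : ∀ α j k, ContDiff ℝ (⊤ : ℕ∞) fun x => diffMat σ x α j k)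
    (hq : ∀ α β, ContDiff ℝ (⊤ : ℕ∞) (q α β))
    (hq_diag : ∀ α x, q α α x = -∑ β ∈ Finset.univ.filter (fun β => β ≠ α), q α β x)
    (hb_per : ∀ α j, Per fun x => b x α j)
    (ha_per : ∀ α j k, Per fun x => diffMat σ x α j k)
    (hq_per : ∀ α β, Per (q α β)) {μ : Fun d m →ₗ[ℝ] ℝ} (h : Sub1 μ)
    (hμ : ∀ f, Test f → μ (gen b (diffMat σ) q f) = 0) (α : Fin m) (k : Fin d → ℤ) :
    (∑ j, (-(2 * Real.pi * Complex.I)) * ((k j : ℂ) * cv (fc fun x => b x α j) (uh μ α) k))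
      + (∑ i, ∑ j, (-(2 * Real.pi ^ 2)) *
          ((k i : ℂ) * (k j : ℂ) * cv (fc fun x => diffMat σ x α i j) (uh μ α) k))
      + ∑ γ, cv (fc (q γ α)) (uh μ γ) k = 0 := by
  set W := (∑ j, (-(2 * Real.pi * Complex.I)) * ((k j : ℂ) * cv (fc fun x => b x α j) (uh μ α) k))
      + (∑ i, ∑ j, (-(2 * Real.pi ^ 2)) *
          ((k i : ℂ) * (k j : ℂ) * cv (fc fun x => diffMat σ x α i j) (uh μ α) k))
      + ∑ γ, cv (fc (q γ α)) (uh μ γ) k with hW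
  have key : ∀ c : ℂ, (c * W).re = 0 := by
    intro c
    set g : (Fin d → ℝ) → ℝ := fun y => (c * ee (-k) y).re with hg
    have hgs : ContDiff ℝ 2 g := Complex.reCLM.contDiff.comp (contDiff_const.mul (contDiff_ee _))
    have hgp : Per g := fun x ν => by simp only [hg, ee_per]
    have hT : Test (sgl α g) := by
      constructor
      · intro γ
        by_cases e : γ = α
        · simpa [sgl, e] using hgs
        · simpa [sgl, e] using contDiff_const
      · intro γ x ν
        by_cases e : γ = α
        · simpa [sgl, e] using hgp x ν
        · simp [sgl, e]
    have h0 := hμ _ hT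
    rw [gen_sgl b _ hq_diag, map_add, map_sum] at h0
    have e1 : ∀ γ, μ (sgl γ fun x => q γ α x * g x) = (c * cv (fc (q γ α)) (uh μ γ) k).re := by
      intro γ
      rw [← h.nu_mul γ (hq γ α) (hq_per γ α) k, ← smul_eq_mul, ← map_smul, nu_re]
      congr 2
      funext x
      simp only [hg, Pi.smul_apply, smul_eq_mul]
      rw [show c * ((q γ α x : ℂ) * ee (-k) x) = (q γ α x : ℂ) * (c * ee (-k) x) by ring,
        Complex.re_ofReal_mul]
    have e2 : μ (sgl α fun x => (∑ j, b x α j * pd g j x)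
        + (1/2) * ∑ i, ∑ j, diffMat σ x α i j * pd2 g i j x)
        = (c * ((∑ j, (-(2 * Real.pi * Complex.I)) * ((k j : ℂ) * cv (fc fun x => b x α j) (uh μ α) k))
      + (∑ i, ∑ j, (-(2 * Real.pi ^ 2)) *
          ((k i : ℂ) * (k j : ℂ) * cv (fc fun x => diffMat σ x α i j) (uh μ α) k)))).re := by
      set G : (Fin d → ℝ) → ℂ :=
        (∑ j, (c * (-(2 * Real.pi * Complex.I) * (k j : ℂ))) • fun x => (b x α j : ℂ) * ee (-k) x)
        + ∑ i, ∑ j, (c * (-(2 * Real.pi ^ 2) * ((k i : ℂ) * (k j : ℂ)))) •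
            fun x => (diffMat σ x α i j : ℂ) * ee (-k) x with hG
      have hn : nu μ α G = c * ((∑ j, (-(2 * Real.pi * Complex.I)) *
            ((k j : ℂ) * cv (fc fun x => b x α j) (uh μ α) k))
          + (∑ i, ∑ j, (-(2 * Real.pi ^ 2)) *
          ((k i : ℂ) * (k j : ℂ) * cv (fc fun x => diffMat σ x α i j) (uh μ α) k))) := by
        rw [hG]
        simp only [map_add, map_sum, map_smul, smul_eq_mul, h.nu_mul α (hb α _) (hb_per α _) k,
          h.nu_mul α (ha α _ _) (ha_per α _ _) k, mul_add, Finset.mul_sum]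
        congr 1
        · exact Finset.sum_congr rfl fun j _ => by ring
        · exact Finset.sum_congr rfl fun i _ => Finset.sum_congr rfl fun j _ => by ring
      rw [← hn, nu_re]
      congr 2
      funext x
      simp only [hG, Pi.add_apply, Finset.sum_apply, Pi.smul_apply, smul_eq_mul, Complex.add_re,
        Complex.re_sum, hg, pd_re_ee, pd2_re_ee, Finset.mul_sum]
      congr 1
      · refine Finset.sum_congr rfl fun j _ => ?_
        rw [← Complex.re_ofReal_mul]
        congr 1
        simp only [Pi.neg_apply, Int.cast_neg]
        ring
      · refine Finset.sum_congr rfl fun i _ => Finset.sum_congr rfl fun j _ => ?_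
        rw [← Complex.re_ofReal_mul, ← Complex.re_ofReal_mul]
        congr 1
        simp only [Pi.neg_apply, Int.cast_neg]
        push_cast
        linear_combination (2 * (diffMat σ x α i j : ℂ) * c * Real.pi ^ 2 * k i * k j * ee (-k) x) * Complex.I_sq
    rw [e2] at h0
    simp only [e1] at h0
    rw [← Complex.re_sum, ← Complex.add_re] at h0
    refine Eq.trans ?_ h0
    rw [hW, mul_add]
    congr 2
    exact Finset.mul_sum _ _ _
  have k1 := key 1
  have k2 := key (-Complex.I)
  apply Complex.ext
  · simpa using k1
  · simpa using k2


/-- Integration against the density represents the functional. -/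
lemma int_density {d m : ℕ} {μ : Fun d m →ₗ[ℝ] ℝ} (h : Sub1 μ) {α : Fin m} (hu : RD (uh μ α))
    {f : (Fin d → ℝ) → ℝ} (hf : ContDiff ℝ (⊤ : ℕ∞) f) (hp : Per f) :
    ∫ x in bx d, f x * (FS (uh μ α) x).re = μ (sgl α f) := by
  have h1 : ∀ x, (f x : ℂ) * FS (uh μ α) x = FS (cv (fc f) (uh μ α)) x := fun x => by
    rw [← FS_fc hf hp, FS_mul (RD_fc hf hp) hu]
  have hcont : Continuous fun x => (f x : ℂ) * FS (uh μ α) x :=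
    (Complex.continuous_ofReal.comp hf.continuous).mul hu.continuous
  have h2 : ∫ x in bx d, (f x : ℂ) * FS (uh μ α) x = nu μ α (fun x => (f x : ℂ)) := by
    simp only [h1]
    rw [int_FS ((RD_fc hf hp).cv hu), ← h.nu_mul α hf hp 0]
    simp [ee_zero]
  have h3 := integral_re (bx_integrable hcont)
  simp only [RCLike.re_to_complex, Complex.re_ofReal_mul] at h3
  rw [h3, h2, nu_re]
  simp

lemma density_nonneg {d m : ℕ} {μ : Fun d m →ₗ[ℝ] ℝ} (h : Sub1 μ) {α : Fin m} (hu : RD (uh μ α))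
    (x : Fin d → ℝ) : 0 ≤ (FS (uh μ α) x).re := by
  set M : (Fin d → ℝ) → ℝ := fun x => (FS (uh μ α) x).re with hM
  have hMs : ContDiff ℝ (⊤ : ℕ∞) M := Complex.reCLM.contDiff.comp hu.contDiff
  have hMp : Per M := fun x ν => by simp only [hM, FS_per]
  set f : (Fin d → ℝ) → ℝ := fun x => expNegInvGlue (-M x) with hf
  have hfs : ContDiff ℝ (⊤ : ℕ∞) f := expNegInvGlue.contDiff.comp hMs.neg
  have hfp : Per f := fun x ν => by simp only [hf, hMp x ν]
  have hf0 : ∀ x, 0 ≤ f x := fun x => expNegInvGlue.nonneg _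
  obtain ⟨C, -, hC⟩ := per_bounded hfs.continuous hfp
  have h1 : 0 ≤ ∫ x in bx d, f x * M x := by
    rw [int_density h hu hfs hfp]
    exact h.nonneg α hC hf0
  have h2 : ∀ x, 0 ≤ -(f x * M x) := by
    intro x
    rcases le_total 0 (M x) with h3 | h3
    · have : f x = 0 := expNegInvGlue.zero_of_nonpos (by linarith)
      simp [this]
    · have := mul_nonneg (hf0 x) (neg_nonneg.2 h3)
      linarith
  have hcont : Continuous fun x => -(f x * M x) := (hfs.continuous.mul hMs.continuous).neg
  have h3 : ∫ x in bx d, -(f x * M x) = 0 := by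
    apply le_antisymm
    · rw [integral_neg]; linarith
    · exact integral_nonneg h2
  by_contra hx
  push Not at hx
  have hneg : ∀ y, M y < 0 → 0 < -(f y * M y) := fun y hy => by
    have := expNegInvGlue.pos_of_pos (x := -M y) (by linarith)
    have := mul_pos this (neg_pos.2 hy)
    simp only [hf]
    linarith
  have h4 := (setIntegral_eq_zero_iff_of_nonneg_ae (Filter.Eventually.of_forall h2)
    (bx_integrable hcont)).1 h3
  rw [Measure.restrict_congr_set (bx_ae d)] at h4
  have hcl : Set.Icc (0 : Fin d → ℝ) 1 ⊆ closure (interior (Set.Icc (0 : Fin d → ℝ) 1)) := by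
    rw [← Set.pi_univ_Icc, interior_pi_set Set.finite_univ, closure_pi_set]
    simp
  have h5 := Measure.eqOn_of_ae_eq h4 hcont.continuousOn continuousOn_const hcl
  obtain ⟨x', hx', he⟩ := per_box x
  have h6 := h5 hx'
  have h7 := hneg x' (by rw [← he M hMp]; exact hx)
  simp only [Pi.zero_apply] at h6
  linarith

lemma adj_eq {d r m : ℕ} {b : (Fin d → ℝ) → Fin m → Fin d → ℝ}
    {σ : (Fin d → ℝ) → Fin m → Matrix (Fin d) (Fin r) ℝ} {q : Fin m → Fin m → (Fin d → ℝ) → ℝ}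
    (hb : ∀ α j, ContDiff ℝ (⊤ : ℕ∞) fun x => b x α j)
    (ha : ∀ α j k, ContDiff ℝ (⊤ : ℕ∞) fun x => diffMat σ x α j k)
    (hq : ∀ α β, ContDiff ℝ (⊤ : ℕ∞) (q α β))
    (hb_per : ∀ α j, Per fun x => b x α j)
    (ha_per : ∀ α j k, Per fun x => diffMat σ x α j k)
    (hq_per : ∀ α β, Per (q α β)) {u : Fin m → (Fin d → ℤ) → ℂ} (hu : ∀ α, RD (u α)) (α : Fin m)
    (hW : ∀ k : Fin d → ℤ, (∑ j, (-(2 * Real.pi * Complex.I)) * ((k j : ℂ) * cv (fc fun x => b x α j) (u α) k))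
      + (∑ i, ∑ j, (-(2 * Real.pi ^ 2)) *
          ((k i : ℂ) * (k j : ℂ) * cv (fc fun x => diffMat σ x α i j) (u α) k))
      + ∑ γ, cv (fc (q γ α)) (u γ) k = 0) (x : Fin d → ℝ) :
    genAdj b (diffMat σ) q (fun x α => (FS (u α) x).re) x α = 0 := by
  have hmul : ∀ (g : (Fin d → ℝ) → ℝ), ContDiff ℝ (⊤ : ℕ∞) g → Per g → ∀ γ,
      (fun y => g y * (FS (u γ) y).re) = fun y => (FS (cv (fc g) (u γ)) y).re := by
    intro g hg hp γ
    funext y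
    rw [← FS_mul (RD_fc hg hp) (hu γ), FS_fc hg hp, Complex.re_ofReal_mul]
  have rb := fun j => (RD_fc (hb α j) (hb_per α j)).cv (hu α)
  have ra := fun i j => (RD_fc (ha α i j) (ha_per α i j)).cv (hu α)
  have rq := fun γ => (RD_fc (hq γ α) (hq_per γ α)).cv (hu γ)
  have e1 : ∀ j, pd (fun y => b y α j * (FS (u α) y).re) j x
      = (FS (fun n => 2 * Real.pi * Complex.I * ((n j : ℂ) * cv (fc fun x => b x α j) (u α) n)) x).re := by
    intro j
    rw [hmul _ (hb α j) (hb_per α j), pd_re_FS (rb j)]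
  have e2 : ∀ i j, pd2 (fun y => diffMat σ y α i j * (FS (u α) y).re) i j x
      = (FS (fun n => 2 * Real.pi * Complex.I * ((n j : ℂ) * (2 * Real.pi * Complex.I *
          ((n i : ℂ) * cv (fc fun x => diffMat σ x α i j) (u α) n)))) x).re := by
    intro i j
    rw [hmul _ (ha α i j) (ha_per α i j)]
    unfold pd2
    simp only [pd_re_FS (ra i j)]
    rw [pd_re_FS (((ra i j).mul_coord i).const_mul _)]
  have e3 : ∀ γ, q γ α x * (FS (u γ) x).re = (FS (cv (fc (q γ α)) (u γ)) x).re := fun γ =>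
    congrFun (hmul _ (hq γ α) (hq_per γ α) γ) x
  unfold genAdj
  simp only [e1, e2, e3]
  have s1 : ∀ j, HasSum _ _ := fun j =>
    ((((rb j).mul_coord j).const_mul (2 * Real.pi * Complex.I)).fs_summable x).of_norm.hasSum
  have s2 : ∀ i j, HasSum _ _ := fun i j =>
    ((((((ra i j).mul_coord i).const_mul (2 * Real.pi * Complex.I)).mul_coord j).const_mul
      (2 * Real.pi * Complex.I)).fs_summable x).of_norm.hasSum
  have s3 : ∀ γ, HasSum _ _ := fun γ => ((rq γ).fs_summable x).of_norm.hasSum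
  have s := ((hasSum_sum (s := univ) fun j _ => s1 j).neg.add
    ((hasSum_sum (s := univ) fun i _ => hasSum_sum (s := univ) fun j _ => s2 i j).mul_left (1/2 : ℂ))).add
    (hasSum_sum (s := univ) fun γ _ => s3 γ)
  have hz := s.unique (f := _) (a₂ := 0) (by
    convert hasSum_zero with n
    have := congrArg (fun z => z * ee n x) (hW n)
    simp only [add_mul, zero_mul, Finset.sum_mul] at this
    rw [← this]
    congr 1
    congr 1
    · rw [← Finset.sum_neg_distrib]
      exact Finset.sum_congr rfl fun j _ => by ring
    · simp only [Finset.mul_sum]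
      refine Finset.sum_congr rfl fun i _ => Finset.sum_congr rfl fun j _ => ?_
      linear_combination (2 * Real.pi ^ 2 * n i * n j * cv (fc fun x => diffMat σ x α i j) (u α) n * ee n x) * Complex.I_sq)
  have hz' := congrArg Complex.re hz
  simp only [Complex.add_re, Complex.neg_re, Complex.re_sum, Complex.zero_re] at hz'
  rw [show (1/2 : ℂ) = ((1/2 : ℝ) : ℂ) by push_cast; rfl, Complex.re_ofReal_mul] at hz'
  simp only [Complex.re_sum] at hz'
  exact hz'

lemma top_two {d : ℕ} {f : (Fin d → ℝ) → ℝ} (hf : ContDiff ℝ (⊤ : ℕ∞) f) : ContDiff ℝ 2 f := by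
  exact_mod_cast contDiff_infty.1 hf 2

lemma density_exists {d r m : ℕ} (hm : 0 < m)
    (b : (Fin d → ℝ) → Fin m → Fin d → ℝ)
    (σ : (Fin d → ℝ) → Fin m → Matrix (Fin d) (Fin r) ℝ)
    (q : Fin m → Fin m → (Fin d → ℝ) → ℝ)
    (amin : ℝ) (hamin : 0 < amin)
    (hb : ∀ α j, ContDiff ℝ (⊤ : ℕ∞) fun x => b x α j)
    (ha : ∀ α j k, ContDiff ℝ (⊤ : ℕ∞) fun x => diffMat σ x α j k)
    (hσ : ∀ α i j, ContDiff ℝ (⊤ : ℕ∞) fun x => σ x α i j)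
    (hell : ∀ (x ξ : Fin d → ℝ) (α : Fin m),
      amin * ∑ i, ξ i ^ 2 ≤ ξ ⬝ᵥ (diffMat σ x α *ᵥ ξ))
    (hq : ∀ α β, ContDiff ℝ (⊤ : ℕ∞) (q α β))
    (hq_nonneg : ∀ α β, α ≠ β → ∀ x, 0 ≤ q α β x)
    (hq_diag : ∀ α x, q α α x = -∑ β ∈ Finset.univ.filter (fun β => β ≠ α), q α β x)
    (hb_per : ∀ α j, Per fun x => b x α j)
    (hσ_per : ∀ α i j, Per fun x => σ x α i j)
    (ha_per : ∀ α j k, Per fun x => diffMat σ x α j k)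
    (hq_per : ∀ α β, Per (q α β)) :
    ∃ M : (Fin d → ℝ) → Fin m → ℝ,
      (∀ x α, 0 ≤ M x α) ∧
      (∀ α, ContDiff ℝ 2 fun x => M x α) ∧
      (∀ α, Per fun x => M x α) ∧
      (∀ x α, genAdj b (diffMat σ) q M x α = 0) ∧
      (∑ α, tInt fun x => M x α) = 1 := by
  obtain ⟨μ, h, hμ⟩ := exists_functional hm b σ q (fun α j => (hb α j).continuous)
    (fun α i j => (hσ α i j).continuous) (fun α β => (hq α β).continuous) hq_nonneg
    hb_per hσ_per hq_per
  have h : Sub1 μ := h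
  have hW := weak_eq hb ha hq hq_diag hb_per ha_per hq_per h hμ
  have hπ : (Real.pi : ℂ) ≠ 0 := by exact_mod_cast Real.pi_ne_zero
  have hu : ∀ α, RD (uh μ α) := by
    refine regularity hamin (A := fun α i j => fc fun x => diffMat σ x α i j)
      (B := fun α j n => (Complex.I / Real.pi) * fc (fun x => b x α j) n)
      (Q := fun α γ n => (-(1 / (2 * Real.pi ^ 2))) * fc (q γ α) n) ?_ ?_ ?_ ?_ (uh μ) h.uh_le ?_
    · intro α F z
      refine ell_finite (fun i j => (ha α i j).continuous) (fun x ξ => (hell x ξ α).trans (le_of_eq ?_)) F z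
      simp only [dotProduct, mulVec, Finset.mul_sum, mul_assoc]
    · exact fun α i j => RD_fc (ha α i j) (ha_per α i j)
    · exact fun α j => (RD_fc (hb α j) (hb_per α j)).const_mul _
    · exact fun α γ => (RD_fc (hq γ α) (hq_per γ α)).const_mul _
    · intro α k
      simp only [cv_const_mul]
      have h1 := hW α k
      simp only [← Finset.mul_sum] at h1 ⊢
      have e : ∑ j, (k j : ℂ) * (Complex.I / Real.pi * cv (fc fun x => b x α j) (uh μ α) k)
          = Complex.I / Real.pi * ∑ j, (k j : ℂ) * cv (fc fun x => b x α j) (uh μ α) k := by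
        rw [Finset.mul_sum]
        exact Finset.sum_congr rfl fun j _ => by ring
      rw [e]
      have h2 := congrArg (fun z => (-(1 / (2 * (Real.pi : ℂ) ^ 2))) * z) h1
      simp only [mul_zero] at h2
      rw [← h2]
      field_simp
      ring
  refine ⟨fun x α => (FS (uh μ α) x).re, fun x α => density_nonneg h (hu α) x, fun α => ?_,
    fun α x ν => ?_, fun x α => ?_, ?_⟩
  · exact top_two (Complex.reCLM.contDiff.comp (hu α).contDiff)
  · simp only [FS_per]
  · exact adj_eq hb ha hq hb_per ha_per hq_per hu α (hW α) x
  · rw [← h.one]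
    refine Finset.sum_congr rfl fun α _ => ?_
    rw [← int_density h (hu α) contDiff_const (fun _ _ => rfl)]
    simp only [one_mul]
    rfl

/-- existence and uniqueness of the invariant density `m(x,α)`:
nonnegative, `C²` and `1`-periodic in `x` for each `α`, solving `ℒ* m = 0`, and
normalized by `∑_α ∫_{𝕋^d} m(x,α) dx = 1`. -/
theorem invariant_density_exists_unique
    {d r m : ℕ} (hd : 0 < d) (hr : 0 < r) (hm : 0 < m)
    (b : (Fin d → ℝ) → Fin m → Fin d → ℝ)
    (σ : (Fin d → ℝ) → Fin m → Matrix (Fin d) (Fin r) ℝ)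
    (q : Fin m → Fin m → (Fin d → ℝ) → ℝ)
    (amin qbar : ℝ) (hamin : 0 < amin)
    (hb : ∀ α j, ContDiff ℝ (⊤ : ℕ∞) fun x => b x α j)
    (hσ : ∀ α i j, ContDiff ℝ (⊤ : ℕ∞) fun x => σ x α i j)
    (hell : ∀ (x ξ : Fin d → ℝ) (α : Fin m),
      amin * ∑ i, ξ i ^ 2 ≤ ξ ⬝ᵥ (diffMat σ x α *ᵥ ξ))
    (hq_smooth : ∀ α β, α ≠ β → ContDiff ℝ (⊤ : ℕ∞) (q α β))
    (hq_nonneg : ∀ α β, α ≠ β → ∀ x, 0 ≤ q α β x)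
    (hq_bdd : ∀ α β, α ≠ β → ∀ x, q α β x ≤ qbar)
    (hq_diag : ∀ α x, q α α x = -∑ β ∈ Finset.univ.filter (fun β => β ≠ α), q α β x)
    (hq_irred : ∀ (x : Fin d → ℝ) (B : Set (Fin m)), B.Nonempty → Bᶜ.Nonempty →
      ∃ α ∈ B, ∃ β ∈ Bᶜ, q α β x ≠ 0)
    (hb_per : ∀ α j, Per fun x => b x α j)
    (hσ_per : ∀ α i j, Per fun x => σ x α i j)
    (hq_per : ∀ α β, Per (q α β)) :
    ∃! M : (Fin d → ℝ) → Fin m → ℝ,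
      (∀ x α, 0 ≤ M x α) ∧
      (∀ α, ContDiff ℝ 2 fun x => M x α) ∧
      (∀ α, Per fun x => M x α) ∧
      (∀ x α, genAdj b (diffMat σ) q M x α = 0) ∧
      (∑ α, tInt fun x => M x α) = 1 := by
  have hq : ∀ α β, ContDiff ℝ (⊤ : ℕ∞) (q α β) := by
    intro α β
    by_cases h : α = β
    · subst h
      have e : q α α = fun x => -∑ β ∈ Finset.univ.filter (fun β => β ≠ α), q α β x :=
        funext fun x => hq_diag α x
      rw [e]
      exact (ContDiff.sum fun β hβ => hq_smooth α β (Finset.mem_filter.1 hβ).2.symm).neg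
    · exact hq_smooth α β h
  have ha : ∀ α j k, ContDiff ℝ (⊤ : ℕ∞) fun x => diffMat σ x α j k := by
    intro α j k
    simp only [diffMat_apply]
    exact ContDiff.sum fun i _ => (hσ α j i).mul (hσ α k i)
  have ha_per : ∀ α j k, Per fun x => diffMat σ x α j k := by
    intro α j k x ν
    simp only [diffMat_apply]
    refine Finset.sum_congr rfl fun i _ => ?_
    have h1 := hσ_per α j i x ν
    have h2 := hσ_per α k i x ν
    simp only at h1 h2
    rw [h1, h2]
  obtain ⟨M, hM⟩ := density_exists hm b σ q amin hamin hb ha hσ hell hq hq_nonneg hq_diag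
    hb_per hσ_per ha_per hq_per
  refine ⟨M, hM, fun N hN => ?_⟩
  exact density_unique hm b σ q amin hamin (fun α j => top_two (hb α j))
    (fun α i j => top_two (hσ α i j)) hell (fun α β => (hq α β).continuous) hq_nonneg hq_irred
    N M hN.1 hM.1 hN.2.1 hM.2.1 hN.2.2.1 hM.2.2.1 hN.2.2.2.1 hM.2.2.2.1 hN.2.2.2.2 hM.2.2.2.2
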